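/- The variance of the discrepancy at blue-draw times satisfies lim_{n→∞} Var(𝔇_{τ_n^𝔅})/(2n) = 1/(2α+1). -/

import Mathlib

open MeasureTheory ProbabilityTheory Filter

/-- The asymptotic condition `1/w(n) = n^α (1 + 2B/n + O(1/n²))` on the weight function. -/
def WeightAsymp (w : ℕ → ℝ) (α B : ℝ) : Prop :=
  ∃ C₀ > (0:ℝ), ∃ N₀ : ℕ, ∀ n : ℕ, N₀ ≤ n →
    |1 / w n - (n:ℝ) ^ α - 2 * B * (n:ℝ) ^ (α - 1)| ≤ C₀ * (n:ℝ) ^ (α - 2)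

/-- The three admissible choices of `(b, r)` in terms of the weight function `w`. -/
def UrnChoice (w b r : ℕ → ℝ) : Prop :=
  (∀ i, b i = w (2*i) ∧ r i = w (2*i+1)) ∨
  (∀ i, b i = w (2*i+1) ∧ r i = w (2*i)) ∨
  (∀ i, b i = w (2*i) ∧ r i = w (2*i))

/-- A generalized Pólya urn process: `Bl n` and `Re n` are the numbers of blue and red
balls drawn in the first `n` draws; started at `(0,0)`, exactly one coordinate increases
by `1` at each step, and conditionally on the past the blue coordinate increases with
probability `b(Bl n)/(b(Bl n) + r(Re n))`. -/
structure Urn {Ω : Type*} [MeasurableSpace Ω] (μ : Measure Ω) (b r : ℕ → ℝ) where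
  Bl : ℕ → Ω → ℕ
  Re : ℕ → Ω → ℕ
  meas_Bl : ∀ n, Measurable (Bl n)
  meas_Re : ∀ n, Measurable (Re n)
  init_Bl : ∀ ω, Bl 0 ω = 0
  init_Re : ∀ ω, Re 0 ω = 0
  step : ∀ n ω, (Bl (n+1) ω = Bl n ω + 1 ∧ Re (n+1) ω = Re n ω) ∨
                (Bl (n+1) ω = Bl n ω ∧ Re (n+1) ω = Re n ω + 1)
  markov : ∀ n : ℕ,
    μ[(fun ω => if Bl (n+1) ω = Bl n ω + 1 then (1:ℝ) else 0) |
        ⨆ j ∈ Set.Iic n, MeasurableSpace.comap (fun ω => (Bl j ω, Re j ω)) inferInstance]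
      =ᵐ[μ] fun ω => b (Bl n ω) / (b (Bl n ω) + r (Re n ω))

namespace Urn

variable {Ω : Type*} [MeasurableSpace Ω] {μ : Measure Ω} {b r : ℕ → ℝ}

/-- The discrepancy `𝔇_n = ℜ_n − 𝔅_n`. -/
def D (U : Urn μ b r) (n : ℕ) (ω : Ω) : ℤ := (U.Re n ω : ℤ) - (U.Bl n ω : ℤ)

/-- `τ_k^𝔅`, the number of draws until the `k`-th blue ball. -/
noncomputable def tau (U : Urn μ b r) : ℕ → Ω → ℕ
  | 0 => fun _ => 0
  | k+1 => fun ω => sInf {n : ℕ | U.tau k ω < n ∧ U.Bl n ω = U.Bl (n-1) ω + 1}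

/-- The natural filtration `ℱ_n = σ((𝔅_j, ℜ_j), j ≤ n)`. -/
def F (U : Urn μ b r) (n : ℕ) : MeasurableSpace Ω :=
  ⨆ j ∈ Set.Iic n, MeasurableSpace.comap (fun ω => (U.Bl j ω, U.Re j ω)) inferInstance

end Urn

lemma rpow_succ_sub_le {β x : ℝ} (hβ : 0 < β) (hx : 0 ≤ x) :
    (x + 1) ^ β - x ^ β ≤ max 1 β * (x + 1) ^ (β - 1) := by
  have h1 : 0 < x + 1 := by linarith
  have hs0 : 0 ≤ x / (x + 1) := by positivity
  have hs1 : x / (x + 1) ≤ 1 := by rw [div_le_one h1]; linarith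
  have hx' : x ^ β = (x / (x + 1)) ^ β * (x + 1) ^ β := by
    rw [← Real.mul_rpow hs0 h1.le, div_mul_cancel₀ _ h1.ne']
  have hp : (x + 1) ^ (β - 1) = (x + 1) ^ β / (x + 1) := Real.rpow_sub_one h1.ne' _
  have key : 1 - max 1 β * (1 / (x + 1)) ≤ (x / (x + 1)) ^ β := by
    have hxs : x / (x + 1) = 1 - 1 / (x + 1) := by field_simp; ring
    have hinv : 0 < 1 / (x + 1) := by positivity
    rcases le_total 1 β with h | h
    · rw [max_eq_right h]
      have := one_add_mul_self_le_rpow_one_add (s := -(1 / (x + 1))) (by linarith) h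
      calc _ = 1 + β * -(1 / (x + 1)) := by ring
        _ ≤ _ := this
        _ = _ := by rw [hxs]; ring_nf
    · rw [max_eq_left h]
      calc _ = (x / (x + 1)) ^ (1 : ℝ) := by rw [Real.rpow_one, hxs]; ring
        _ ≤ _ := Real.rpow_le_rpow_of_exponent_ge' hs0 hs1 hβ.le h
  have hpos : 0 < (x + 1) ^ β := by positivity
  rw [hx', hp]
  have := mul_le_mul_of_nonneg_right key hpos.le
  have e : max 1 β * ((x + 1) ^ β / (x + 1)) = max 1 β * (1 / (x + 1)) * (x + 1) ^ β := by ring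
  rw [e]; linarith

lemma le_rpow_succ_sub {β x : ℝ} (hβ : 0 < β) (hx : 0 ≤ x) :
    min 1 β * (x + 1) ^ (β - 1) ≤ (x + 1) ^ β - x ^ β := by
  have h1 : 0 < x + 1 := by linarith
  have hs0 : 0 ≤ x / (x + 1) := by positivity
  have hs1 : x / (x + 1) ≤ 1 := by rw [div_le_one h1]; linarith
  have hx' : x ^ β = (x / (x + 1)) ^ β * (x + 1) ^ β := by
    rw [← Real.mul_rpow hs0 h1.le, div_mul_cancel₀ _ h1.ne']
  have hp : (x + 1) ^ (β - 1) = (x + 1) ^ β / (x + 1) := Real.rpow_sub_one h1.ne' _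
  have key : (x / (x + 1)) ^ β ≤ 1 - min 1 β * (1 / (x + 1)) := by
    have hxs : x / (x + 1) = 1 - 1 / (x + 1) := by field_simp; ring
    rcases le_total 1 β with h | h
    · rw [min_eq_left h]
      calc _ ≤ (x / (x + 1)) ^ (1 : ℝ) :=
            Real.rpow_le_rpow_of_exponent_ge' hs0 hs1 zero_le_one h
        _ = _ := by rw [Real.rpow_one, hxs]; ring
    · rw [min_eq_right h]
      have := rpow_one_add_le_one_add_mul_self (s := -(1 / (x + 1))) (by linarith) hβ.le h
      calc _ = (1 + -(1 / (x + 1))) ^ β := by rw [hxs]; ring_nf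
        _ ≤ _ := this
        _ = _ := by ring
  have hpos : 0 < (x + 1) ^ β := by positivity
  rw [hx', hp]
  have := mul_le_mul_of_nonneg_right key hpos.le
  have e : min 1 β * ((x + 1) ^ β / (x + 1)) = min 1 β * (1 / (x + 1)) * (x + 1) ^ β := by ring
  rw [e]; linarith

/-- Tangent line bounds for the convex function `x ^ (β + 1)` on `[x, x + 1]`. -/
lemma rpow_add_one_succ_sub_bounds {β x : ℝ} (hβ : 0 < β) (hx : 0 ≤ x) :
    (β + 1) * x ^ β ≤ (x + 1) ^ (β + 1) - x ^ (β + 1) ∧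
      (x + 1) ^ (β + 1) - x ^ (β + 1) ≤ (β + 1) * (x + 1) ^ β := by
  have h1 : 0 < x + 1 := by linarith
  constructor
  · rcases hx.eq_or_lt with h0 | h0
    · subst h0
      simp [Real.zero_rpow hβ.ne', Real.zero_rpow (by linarith : β + 1 ≠ 0)]
    · have := one_add_mul_self_le_rpow_one_add (s := 1 / x) (p := β + 1)
        (by have : 0 < 1 / x := by positivity
            linarith) (by linarith)
      have e : (x + 1) ^ (β + 1) = (1 + 1 / x) ^ (β + 1) * x ^ (β + 1) := by
        rw [← Real.mul_rpow (by positivity) h0.le]; congr 1; field_simp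
      have e2 : x ^ (β + 1) = x ^ β * x := Real.rpow_add_one h0.ne' _
      have h3 := mul_le_mul_of_nonneg_right this (by positivity : 0 ≤ x ^ (β + 1))
      have e3 : (1 + (β + 1) * (1 / x)) * x ^ (β + 1) = x ^ (β + 1) + (β + 1) * x ^ β := by
        rw [e2]; field_simp
      rw [e]; linarith
  · have hinv : 1 / (x + 1) ≤ 1 := by rw [div_le_one h1]; linarith
    have := one_add_mul_self_le_rpow_one_add (s := -(1 / (x + 1))) (p := β + 1)
        (by linarith) (by linarith)
    have e : x ^ (β + 1) = (1 + -(1 / (x + 1))) ^ (β + 1) * (x + 1) ^ (β + 1) := by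
      rw [← Real.mul_rpow (by linarith) h1.le]; congr 1; field_simp; ring
    have e2 : (x + 1) ^ (β + 1) = (x + 1) ^ β * (x + 1) := Real.rpow_add_one h1.ne' _
    have h3 := mul_le_mul_of_nonneg_right this (by positivity : 0 ≤ (x + 1) ^ (β + 1))
    have e3 : (1 + (β + 1) * -(1 / (x + 1))) * (x + 1) ^ (β + 1)
        = (x + 1) ^ (β + 1) - (β + 1) * (x + 1) ^ β := by
      rw [e2]; field_simp; ring
    linarith

lemma abs_sum_sub_rpow_le {β c C : ℝ} (hβ : 0 < β) (hC : 0 ≤ C) {x : ℕ → ℝ}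
    (hx : ∀ j : ℕ, |x j - c * (j : ℝ) ^ β| ≤ C * ((j : ℝ) + 1) ^ (β - 1)) (k : ℕ) :
    |∑ j ∈ Finset.range k, x j - c * ((k : ℝ) ^ (β + 1) / (β + 1))|
      ≤ (|c| + C / min 1 β) * (k : ℝ) ^ β := by
  have hm : 0 < min 1 β := lt_min one_pos hβ
  induction k with
  | zero => simp [Real.zero_rpow hβ.ne', Real.zero_rpow (by linarith : β + 1 ≠ 0)]
  | succ k ih =>
    have hk : (0 : ℝ) ≤ k := k.cast_nonneg
    obtain ⟨h1, h2⟩ := rpow_add_one_succ_sub_bounds hβ hk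
    have h3 := le_rpow_succ_sub hβ hk
    rw [Finset.sum_range_succ]
    push_cast
    have e1 : |x k - c * (k : ℝ) ^ β| ≤ C / min 1 β * (((k : ℝ) + 1) ^ β - (k : ℝ) ^ β) := by
      refine (hx k).trans ?_
      rw [div_mul_eq_mul_div, le_div_iff₀ hm]
      nlinarith
    have e2 : |c * ((k : ℝ) ^ β
        - (((k : ℝ) + 1) ^ (β + 1) / (β + 1) - (k : ℝ) ^ (β + 1) / (β + 1)))|
          ≤ |c| * (((k : ℝ) + 1) ^ β - (k : ℝ) ^ β) := by
      rw [abs_mul]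
      refine mul_le_mul_of_nonneg_left ?_ (abs_nonneg c)
      rw [← sub_div, abs_le]
      have hb : 0 < β + 1 := by linarith
      have g1 : (k : ℝ) ^ β ≤ (((k : ℝ) + 1) ^ (β + 1) - (k : ℝ) ^ (β + 1)) / (β + 1) := by
        rw [le_div_iff₀ hb]; linarith
      have g2 : (((k : ℝ) + 1) ^ (β + 1) - (k : ℝ) ^ (β + 1)) / (β + 1) ≤ ((k : ℝ) + 1) ^ β := by
        rw [div_le_iff₀ hb]; linarith
      constructor <;> linarith
    have key : ∑ j ∈ Finset.range k, x j + x k - c * (((k : ℝ) + 1) ^ (β + 1) / (β + 1))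
        = (∑ j ∈ Finset.range k, x j - c * ((k : ℝ) ^ (β + 1) / (β + 1)))
          + (x k - c * (k : ℝ) ^ β)
          + c * ((k : ℝ) ^ β
            - (((k : ℝ) + 1) ^ (β + 1) / (β + 1) - (k : ℝ) ^ (β + 1) / (β + 1))) := by ring
    rw [key]
    refine (abs_add_three _ _ _).trans ?_
    nlinarith [ih, e1, e2]

lemma rpow_sub_tangent_le {s u : ℝ} (hs : 1 ≤ s) (hu : 0 ≤ u) :
    |u ^ s - 1 - s * (u - 1)| ≤ 4 * s * (u ^ s - 1) ^ 2 := by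
  have hB := one_add_mul_self_le_rpow_one_add (s := u - 1) (p := s) (by linarith) hs
  rw [add_sub_cancel] at hB
  rw [abs_of_nonneg (by linarith)]
  rcases lt_or_ge (u ^ s) (1 / 2) with hy | hy
  · have h0 : 0 ≤ u ^ s := by positivity
    have : s * 1 ≤ s * (4 * (u ^ s - 1) ^ 2) := by
      refine mul_le_mul_of_nonneg_left ?_ (by linarith)
      nlinarith
    nlinarith [mul_nonneg (by linarith : 0 ≤ s) hu]
  · have hu0 : 0 < u := by
      rcases hu.eq_or_lt with h | h
      · rw [← h, Real.zero_rpow (by linarith)] at hy; norm_num at hy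
      · exact h
    have hB' := one_add_mul_self_le_rpow_one_add (s := u⁻¹ - 1) (p := s)
      (by have : 0 < u⁻¹ := by positivity
          linarith) hs
    rw [add_sub_cancel, Real.inv_rpow hu] at hB'
    set y := u ^ s with hy'
    have hy0 : 0 < y := by linarith
    have h2 : u * (y - 1) ≤ s * (u - 1) * y := by
      have := mul_le_mul_of_nonneg_right hB' (by positivity : 0 ≤ u * y)
      have e1 : (1 + s * (u⁻¹ - 1)) * (u * y) = u * y + s * (1 - u) * y := by field_simp
      have e2 : y⁻¹ * (u * y) = u := by field_simp
      rw [e1, e2] at this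
      nlinarith
    have h3 : (y - 1) * (y - u) ≤ (y - 1) ^ 2 := by
      rcases le_total 1 u with h | h
      · have : 1 ≤ y := Real.one_le_rpow h (by linarith)
        nlinarith
      · have : y ≤ 1 := Real.rpow_le_one hu h (by linarith)
        nlinarith
    have h4 : (y - 1 - s * (u - 1)) * y ≤ (y - 1) ^ 2 := by nlinarith
    have h5 : y - 1 - s * (u - 1) ≤ 2 * (y - 1) ^ 2 := by nlinarith
    nlinarith [sq_nonneg (y - 1)]

lemma abs_rpow_sub_one_le {α u : ℝ} (hα : 0 < α) (hu : 0 ≤ u) :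
    |u ^ (2 * α + 1) - 1| ≤ 2 * |u ^ (α + 1) - 1| + (u ^ (α + 1) - 1) ^ 2 := by
  have e : u ^ (2 * α + 2) = (u ^ (α + 1)) ^ 2 := by
    rw [← Real.rpow_mul_natCast hu]; congr 1; push_cast; ring
  rcases le_total 1 u with h | h
  · have h1 : 1 ≤ u ^ (2 * α + 1) := Real.one_le_rpow h (by linarith)
    have h2 : 1 ≤ u ^ (α + 1) := Real.one_le_rpow h (by linarith)
    have h3 : u ^ (2 * α + 1) ≤ u ^ (2 * α + 2) := Real.rpow_le_rpow_of_exponent_le h (by linarith)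
    rw [abs_of_nonneg (by linarith), abs_of_nonneg (by linarith)]
    nlinarith
  · have h1 : u ^ (2 * α + 1) ≤ 1 := Real.rpow_le_one hu h (by linarith)
    have h2 : u ^ (α + 1) ≤ 1 := Real.rpow_le_one hu h (by linarith)
    have h3 : u ^ (2 * α + 2) ≤ u ^ (2 * α + 1) :=
      Real.rpow_le_rpow_of_exponent_ge' hu h (by linarith) (by linarith)
    rw [abs_of_nonpos (by linarith), abs_of_nonpos (by linarith)]
    nlinarith [sq_nonneg (u ^ (α + 1) - 1)]

lemma rpow_le_one_add_pow {α u s : ℝ} (p : ℕ) (hs : 0 ≤ s) (hsp : s ≤ p * (α + 1))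
    (hu : 0 ≤ u) : u ^ s ≤ 1 + (u ^ (α + 1)) ^ p := by
  have h0 : 0 ≤ (u ^ (α + 1)) ^ p := by positivity
  rcases le_total 1 u with h | h
  · have : u ^ s ≤ u ^ (p * (α + 1)) := Real.rpow_le_rpow_of_exponent_le h hsp
    rw [mul_comm, Real.rpow_mul_natCast hu] at this
    linarith
  · have : u ^ s ≤ 1 := Real.rpow_le_one hu h hs
    linarith

lemma exists_forall_bound_of_eventually {f : ℕ → ℝ} {α C : ℝ} {N : ℕ}
    (h : ∀ n, N ≤ n → |f n| ≤ C * ((n : ℝ) + 1) ^ (α - 1)) :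
    ∃ C' : ℝ, 0 ≤ C' ∧ ∀ n : ℕ, |f n| ≤ C' * ((n : ℝ) + 1) ^ (α - 1) := by
  have hO : f =O[atTop] fun n : ℕ => ((n : ℝ) + 1) ^ (α - 1) := by
    refine Asymptotics.IsBigO.of_bound C (eventually_atTop.2 ⟨N, fun n hn => ?_⟩)
    have : 0 < ((n : ℝ) + 1) ^ (α - 1) := by positivity
    simpa [Real.norm_eq_abs, abs_of_pos this] using h n hn
  obtain ⟨C', hC', hb⟩ := Asymptotics.bound_of_isBigO_nat_atTop hO
  refine ⟨C', hC'.le, fun n => ?_⟩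
  have : 0 < ((n : ℝ) + 1) ^ (α - 1) := by positivity
  simpa [Real.norm_eq_abs, abs_of_pos this] using hb this.ne'

lemma rpow_sub_one_le_of_double {α x i : ℝ} (hα : 0 < α) (hi : 0 ≤ i) (h1 : i + 1 ≤ x)
    (h2 : x ≤ 2 * (i + 1)) : x ^ (α - 1) ≤ 2 ^ α * (i + 1) ^ (α - 1) := by
  have hi1 : 0 < i + 1 := by linarith
  have hx : 0 < x := by linarith
  have hp : 0 < (i + 1) ^ (α - 1) := by positivity
  rcases le_total 1 α with h | h
  · calc x ^ (α - 1) ≤ (2 * (i + 1)) ^ (α - 1) := Real.rpow_le_rpow hx.le h2 (by linarith)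
      _ = 2 ^ (α - 1) * (i + 1) ^ (α - 1) := Real.mul_rpow (by norm_num) hi1.le
      _ ≤ _ := by
        gcongr
        · norm_num
        · linarith
  · calc x ^ (α - 1) ≤ (i + 1) ^ (α - 1) :=
          Real.rpow_le_rpow_of_nonpos hi1 h1 (by linarith)
      _ ≤ _ := le_mul_of_one_le_left hp.le (Real.one_le_rpow (by norm_num) hα.le)

lemma WeightAsymp.inv_bound {w : ℕ → ℝ} {α B : ℝ} (h : WeightAsymp w α B) :
    ∃ C : ℝ, 0 ≤ C ∧ ∃ N : ℕ, 1 ≤ N ∧ ∀ n : ℕ, N ≤ n →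
      |(w n)⁻¹ - (n : ℝ) ^ α| ≤ C * (n : ℝ) ^ (α - 1) := by
  obtain ⟨C₀, hC₀, N₀, hN⟩ := h
  refine ⟨2 * |B| + C₀, by positivity, max N₀ 1, le_max_right _ _, fun n hn => ?_⟩
  have h1 := hN n ((le_max_left _ _).trans hn)
  have hn1 : (1 : ℝ) ≤ n := by exact_mod_cast (le_max_right _ _).trans hn
  have h2 : (n : ℝ) ^ (α - 2) ≤ (n : ℝ) ^ (α - 1) :=
    Real.rpow_le_rpow_of_exponent_le hn1 (by linarith)
  have hp : 0 < (n : ℝ) ^ (α - 1) := by positivity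
  rw [one_div] at h1
  have e : (w n)⁻¹ - (n : ℝ) ^ α = ((w n)⁻¹ - (n : ℝ) ^ α - 2 * B * (n : ℝ) ^ (α - 1))
      + 2 * B * (n : ℝ) ^ (α - 1) := by ring
  rw [e]
  refine (abs_add_le _ _).trans ?_
  rw [abs_mul (2 * B), abs_of_pos hp, abs_mul, abs_two]
  nlinarith

lemma WeightAsymp.even_bound {w : ℕ → ℝ} {α B : ℝ} (hα : 0 < α) (h : WeightAsymp w α B) :
    ∃ C : ℝ, 0 ≤ C ∧ ∀ i : ℕ,
      |(w (2 * i))⁻¹ - 2 ^ α * (i : ℝ) ^ α| ≤ C * ((i : ℝ) + 1) ^ (α - 1) := by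
  obtain ⟨C, hC, N, hN1, hN⟩ := h.inv_bound
  refine exists_forall_bound_of_eventually (N := N) (C := C * 2 ^ α) fun i hi => ?_
  have hi1 : (1 : ℝ) ≤ i := by exact_mod_cast hN1.trans hi
  have := hN (2 * i) (by omega)
  push_cast at this
  rw [Real.mul_rpow zero_le_two (by linarith)] at this
  refine this.trans ?_
  rw [mul_assoc]
  exact mul_le_mul_of_nonneg_left
    (rpow_sub_one_le_of_double hα (by linarith) (by linarith) (by linarith)) hC

lemma WeightAsymp.odd_bound {w : ℕ → ℝ} {α B : ℝ} (hα : 0 < α) (h : WeightAsymp w α B) :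
    ∃ C : ℝ, 0 ≤ C ∧ ∀ i : ℕ,
      |(w (2 * i + 1))⁻¹ - 2 ^ α * (i : ℝ) ^ α| ≤ C * ((i : ℝ) + 1) ^ (α - 1) := by
  obtain ⟨C, hC, N, hN1, hN⟩ := h.inv_bound
  refine exists_forall_bound_of_eventually (N := N) (C := (C + max 1 α) * 2 ^ α) fun i hi => ?_
  have hi1 : (1 : ℝ) ≤ i := by exact_mod_cast hN1.trans hi
  have h1 := hN (2 * i + 1) (by omega)
  push_cast at h1
  have h2 := rpow_succ_sub_le hα (x := 2 * i) (by linarith)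
  have h3 : (2 * (i : ℝ)) ^ α ≤ (2 * i + 1) ^ α :=
    Real.rpow_le_rpow (by linarith) (by linarith) hα.le
  have h4 := rpow_sub_one_le_of_double hα (x := 2 * i + 1) (i := i) (by linarith) (by linarith)
    (by linarith)
  have e0 : (2 : ℝ) ^ α * (i : ℝ) ^ α = (2 * i) ^ α :=
    (Real.mul_rpow zero_le_two (by linarith)).symm
  have hm : 0 ≤ max 1 α := by positivity
  rw [e0]
  calc |(w (2 * i + 1))⁻¹ - (2 * (i : ℝ)) ^ α|
      ≤ |(w (2 * i + 1))⁻¹ - (2 * (i : ℝ) + 1) ^ α| + |(2 * (i : ℝ) + 1) ^ α - (2 * (i : ℝ)) ^ α| :=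
        abs_sub_le _ _ _
    _ ≤ (C + max 1 α) * (2 * (i : ℝ) + 1) ^ (α - 1) := by
        rw [abs_of_nonneg (sub_nonneg.2 h3)]; linarith
    _ ≤ _ := by
        rw [mul_assoc]; exact mul_le_mul_of_nonneg_left h4 (by positivity)

/-- Both inverse rate sequences grow like `L * i ^ α`, up to a relative error `O(1 / i)`. -/
def RateAsymp (α L : ℝ) (b : ℕ → ℝ) : Prop :=
  ∃ C : ℝ, 0 ≤ C ∧ ∀ i : ℕ, |(b i)⁻¹ - L * (i : ℝ) ^ α| ≤ C * ((i : ℝ) + 1) ^ (α - 1)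

lemma UrnChoice.rateAsymp {w b r : ℕ → ℝ} {α B : ℝ} (hα : 0 < α) (hw : WeightAsymp w α B)
    (h : UrnChoice w b r) : RateAsymp α (2 ^ α) b ∧ RateAsymp α (2 ^ α) r := by
  rcases h with h | h | h
  · simp only [RateAsymp, h]; exact ⟨hw.even_bound hα, hw.odd_bound hα⟩
  · simp only [RateAsymp, h]; exact ⟨hw.odd_bound hα, hw.even_bound hα⟩
  · simp only [RateAsymp, h]; exact ⟨hw.even_bound hα, hw.even_bound hα⟩

lemma RateAsymp.inv_le {α L : ℝ} {b : ℕ → ℝ} (hα : 0 < α) (hL : 0 < L) (h : RateAsymp α L b) :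
    ∃ C : ℝ, 0 ≤ C ∧ ∀ i : ℕ, |(b i)⁻¹| ≤ C * ((i : ℝ) + 1) ^ α := by
  obtain ⟨C, hC, hb⟩ := h
  refine ⟨L + C, by positivity, fun i => ?_⟩
  have hi : (0 : ℝ) ≤ i := i.cast_nonneg
  have h1 : ((i : ℝ) + 1) ^ (α - 1) ≤ ((i : ℝ) + 1) ^ α :=
    Real.rpow_le_rpow_of_exponent_le (by linarith) (by linarith)
  have h2 : (i : ℝ) ^ α ≤ ((i : ℝ) + 1) ^ α := Real.rpow_le_rpow hi (by linarith) hα.le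
  have h3 : 0 ≤ (i : ℝ) ^ α := by positivity
  have e : (b i)⁻¹ = ((b i)⁻¹ - L * (i : ℝ) ^ α) + L * (i : ℝ) ^ α := by ring
  rw [e]
  refine (abs_add_le _ _).trans ?_
  rw [abs_of_nonneg (by positivity : 0 ≤ L * (i : ℝ) ^ α)]
  nlinarith [hb i]

lemma RateAsymp.sum_inv {α L : ℝ} {b : ℕ → ℝ} (hα : 0 < α) (h : RateAsymp α L b) :
    ∃ C : ℝ, 0 ≤ C ∧ ∀ k : ℕ,
      |∑ j ∈ Finset.range k, (b j)⁻¹ - L * ((k : ℝ) ^ (α + 1) / (α + 1))| ≤ C * (k : ℝ) ^ α := by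
  obtain ⟨C, hC, hb⟩ := h
  exact ⟨_, by positivity, abs_sum_sub_rpow_le hα hC hb⟩

lemma RateAsymp.sum_inv_sq {α L : ℝ} {b : ℕ → ℝ} (hα : 0 < α) (hL : 0 < L)
    (h : RateAsymp α L b) :
    ∃ C : ℝ, 0 ≤ C ∧ ∀ k : ℕ,
      |∑ j ∈ Finset.range k, ((b j)⁻¹) ^ 2 - L ^ 2 * ((k : ℝ) ^ (2 * α + 1) / (2 * α + 1))|
        ≤ C * (k : ℝ) ^ (2 * α) := by
  obtain ⟨D, hD, hD'⟩ := h.inv_le hα hL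
  obtain ⟨C, hC, hb⟩ := h
  refine ⟨_, ?_, abs_sum_sub_rpow_le (β := 2 * α) (c := L ^ 2) (C := C * (D + L)) (by positivity)
    (by positivity) fun j => ?_⟩
  · positivity
  · have hj : (0 : ℝ) ≤ j := j.cast_nonneg
    have hj1 : (0 : ℝ) < (j : ℝ) + 1 := by linarith
    have e1 : (j : ℝ) ^ (2 * α) = ((j : ℝ) ^ α) ^ 2 := by
      rw [← Real.rpow_mul_natCast hj, mul_comm]; norm_num
    have e2 : ((j : ℝ) + 1) ^ (2 * α - 1) = ((j : ℝ) + 1) ^ (α - 1) * ((j : ℝ) + 1) ^ α := by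
      rw [← Real.rpow_add hj1]; congr 1; ring
    have e3 : ((b j)⁻¹) ^ 2 - L ^ 2 * ((j : ℝ) ^ α) ^ 2
        = ((b j)⁻¹ - L * (j : ℝ) ^ α) * ((b j)⁻¹ + L * (j : ℝ) ^ α) := by ring
    have h2 : (j : ℝ) ^ α ≤ ((j : ℝ) + 1) ^ α := Real.rpow_le_rpow hj (by linarith) hα.le
    have h3 : 0 ≤ (j : ℝ) ^ α := by positivity
    have h4 : |(b j)⁻¹ + L * (j : ℝ) ^ α| ≤ (D + L) * ((j : ℝ) + 1) ^ α := by
      refine (abs_add_le _ _).trans ?_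
      rw [abs_of_nonneg (by positivity : 0 ≤ L * (j : ℝ) ^ α)]
      nlinarith [hD' j]
    rw [e1, e2, e3, abs_mul]
    calc _ ≤ (C * ((j : ℝ) + 1) ^ (α - 1)) * ((D + L) * ((j : ℝ) + 1) ^ α) :=
          mul_le_mul (hb j) h4 (abs_nonneg _) (by positivity)
      _ = _ := by ring

lemma RateAsymp.sum_inv_pow_le {α L : ℝ} {b : ℕ → ℝ} (hα : 0 < α) (hL : 0 < L)
    (h : RateAsymp α L b) (p : ℕ) :
    ∃ C : ℝ, 0 ≤ C ∧ ∀ k : ℕ,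
      ∑ j ∈ Finset.range k, |(b j)⁻¹| ^ p ≤ C * (k : ℝ) ^ (p * α + 1) := by
  obtain ⟨D, hD, hD'⟩ := h.inv_le hα hL
  refine ⟨D ^ p, by positivity, fun k => ?_⟩
  have hk : (0 : ℝ) ≤ k := k.cast_nonneg
  rcases k.eq_zero_or_pos with rfl | hk0
  · simp; positivity
  have hk0 : (0 : ℝ) < k := by exact_mod_cast hk0
  calc _ ≤ ∑ j ∈ Finset.range k, (D * (k : ℝ) ^ α) ^ p := by
        refine Finset.sum_le_sum fun j hj => pow_le_pow_left₀ (abs_nonneg _) ((hD' j).trans ?_) _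
        have : (j : ℝ) + 1 ≤ k := by exact_mod_cast Finset.mem_range.1 hj
        gcongr
    _ = _ := by
        rw [Finset.sum_const, Finset.card_range, nsmul_eq_mul, mul_pow,
          ← Real.rpow_mul_natCast hk, Real.rpow_add_one hk0.ne', mul_comm α]
        ring

/-- The `m`-th signed power sum of the inverse rates of the first `i` blue and `k` red draws. -/
noncomputable def powerSum (b r : ℕ → ℝ) (m i k : ℕ) : ℝ :=
  ∑ j ∈ Finset.range i, ((b j)⁻¹) ^ m + ∑ j ∈ Finset.range k, (-(r j)⁻¹) ^ m

lemma natCast_rpow_div {n k : ℕ} (hn : 1 ≤ n) (s : ℝ) :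
    (k : ℝ) ^ s = ((k : ℝ) / n) ^ s * (n : ℝ) ^ s := by
  have hn0 : (0 : ℝ) < n := by exact_mod_cast hn
  rw [← Real.mul_rpow (by positivity) hn0.le, div_mul_cancel₀ _ hn0.ne']

section Deterministic

variable {α L : ℝ} {b r : ℕ → ℝ}

/-- The rescaled first power sum is an affine function of `(k / n) ^ (α + 1)`, up to `O(1 / n)`. -/
lemma scaled_powerSum_one_approx (hα : 0 < α) (hb : RateAsymp α L b)
    (hr : RateAsymp α L r) :
    ∃ C : ℝ, 0 ≤ C ∧ ∀ n k : ℕ, 1 ≤ n →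
      |powerSum b r 1 n k / (n : ℝ) ^ (α + 1) + L / (α + 1) * (((k : ℝ) / n) ^ (α + 1) - 1)|
        ≤ C * (3 + |((k : ℝ) / n) ^ (α + 1) - 1|) * (1 / n) := by
  obtain ⟨C1, hC1, h1⟩ := hb.sum_inv hα
  obtain ⟨C2, hC2, h2⟩ := hr.sum_inv hα
  refine ⟨C1 + C2, by positivity, fun n k hn => ?_⟩
  have hn0 : (0 : ℝ) < n := by exact_mod_cast hn
  have hu : 0 ≤ (k : ℝ) / n := by positivity
  have h1 := h1 n
  have h2 := h2 k
  rw [natCast_rpow_div hn (α + 1), natCast_rpow_div hn α] at h2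
  set u := (k : ℝ) / n with hu'
  have hN : 0 < (n : ℝ) ^ α := by positivity
  have hN1 : (n : ℝ) ^ (α + 1) = (n : ℝ) ^ α * n := Real.rpow_add_one hn0.ne' _
  have huα : u ^ α ≤ 1 + u ^ (α + 1) := by
    have := rpow_le_one_add_pow (α := α) 1 hα.le (by push_cast; linarith) hu
    simpa using this
  have e : powerSum b r 1 n k / (n : ℝ) ^ (α + 1) + L / (α + 1) * (u ^ (α + 1) - 1)
      = ((∑ j ∈ Finset.range n, (b j)⁻¹ - L * ((n : ℝ) ^ (α + 1) / (α + 1)))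
        - (∑ j ∈ Finset.range k, (r j)⁻¹ - L * (u ^ (α + 1) * (n : ℝ) ^ (α + 1) / (α + 1))))
          / (n : ℝ) ^ (α + 1) := by
    have : (n : ℝ) ^ (α + 1) ≠ 0 := by positivity
    have : α + 1 ≠ 0 := by linarith
    simp only [powerSum, pow_one, Finset.sum_neg_distrib]
    field_simp
    ring
  have hh := le_abs_self (u ^ (α + 1) - 1)
  have hh0 := abs_nonneg (u ^ (α + 1) - 1)
  rw [e, abs_div, abs_of_pos (by positivity : 0 < (n : ℝ) ^ (α + 1)), div_le_iff₀ (by positivity)]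
  refine (abs_sub _ _).trans ?_
  have e2 : (C1 + C2) * (3 + |u ^ (α + 1) - 1|) * (1 / n) * (n : ℝ) ^ (α + 1)
      = (C1 + C2) * (3 + |u ^ (α + 1) - 1|) * (n : ℝ) ^ α := by
    rw [hN1]; field_simp
  rw [e2]
  calc _ ≤ C1 * (n : ℝ) ^ α + C2 * (u ^ α * (n : ℝ) ^ α) := add_le_add h1 h2
    _ = (C1 + C2 * u ^ α) * (n : ℝ) ^ α := by ring
    _ ≤ _ := by
      refine mul_le_mul_of_nonneg_right ?_ hN.le
      nlinarith [mul_nonneg hC1 hh0]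

/-- The rescaled first power sum controls `(k / n) ^ (α + 1) - 1`. -/
lemma abs_ratio_rpow_sub_one_le (hα : 0 < α) (hL : 0 < L) (hb : RateAsymp α L b)
    (hr : RateAsymp α L r) :
    ∃ K : ℝ, 0 ≤ K ∧ ∃ n₀ : ℕ, ∀ n k : ℕ, 1 ≤ n → n₀ ≤ n →
      |((k : ℝ) / n) ^ (α + 1) - 1| ≤ K * (|powerSum b r 1 n k / (n : ℝ) ^ (α + 1)| + 1 / n) := by
  obtain ⟨C, hC, h⟩ := scaled_powerSum_one_approx hα hb hr
  set κ := L / (α + 1) with hκ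
  have hκ0 : 0 < κ := by positivity
  refine ⟨2 / κ * (1 + 3 * C), by positivity, ⌈2 * C / κ⌉₊, fun n k hn hn0 => ?_⟩
  have hn1 : (0 : ℝ) < n := by exact_mod_cast hn
  have hCn : C * (1 / n) ≤ κ / 2 := by
    have h2 : 2 * C / κ ≤ n := Nat.ceil_le.1 hn0
    rw [div_le_iff₀ hκ0] at h2
    rw [mul_one_div, div_le_iff₀ hn1]; linarith
  have h1 := h n k hn
  set h' := ((k : ℝ) / n) ^ (α + 1) - 1
  set m := powerSum b r 1 n k / (n : ℝ) ^ (α + 1)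
  have hε : (0 : ℝ) < 1 / n := by positivity
  have h2 : κ * |h'| ≤ |m + κ * h'| + |m| := by
    have : κ * h' = (m + κ * h') - m := by ring
    calc κ * |h'| = |(m + κ * h') - m| := by rw [← this, abs_mul, abs_of_pos hκ0]
      _ ≤ _ := abs_sub _ _
  have h3 : κ / 2 * |h'| ≤ |m| + 3 * C * (1 / n) := by
    nlinarith [mul_le_mul_of_nonneg_right hCn (abs_nonneg h')]
  have h4 : |h'| ≤ 2 / κ * (|m| + 3 * C * (1 / n)) := by
    rw [div_mul_eq_mul_div, le_div_iff₀ hκ0]; linarith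
  refine h4.trans ?_
  rw [mul_assoc (2 / κ)]
  refine mul_le_mul_of_nonneg_left ?_ (by positivity : 0 ≤ 2 / κ)
  nlinarith [mul_nonneg hC (abs_nonneg m)]

lemma discrepancy_linearization (hα : 0 < α) (hL : 0 < L) (hb : RateAsymp α L b)
    (hr : RateAsymp α L r) :
    ∃ C : ℝ, 0 ≤ C ∧ ∃ n₀ : ℕ, ∀ n k : ℕ, 1 ≤ n → n₀ ≤ n →
      |powerSum b r 1 n k / (n : ℝ) ^ (α + 1) + L * ((k : ℝ) / n - 1)|
        ≤ C * ((powerSum b r 1 n k / (n : ℝ) ^ (α + 1)) ^ 2 + 1 / n) := by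
  obtain ⟨C, hC, h⟩ := scaled_powerSum_one_approx hα hb hr
  obtain ⟨K, hK, n₀, hK'⟩ := abs_ratio_rpow_sub_one_le hα hL hb hr
  set κ := L / (α + 1) with hκ
  have hκ0 : 0 < κ := by positivity
  refine ⟨4 * C + (C + κ * (4 * (α + 1))) * (2 * K ^ 2), by positivity, n₀, fun n k hn hn0 => ?_⟩
  have h1 := h n k hn
  have h2 := hK' n k hn hn0
  have hn1 : (1 : ℝ) ≤ n := by exact_mod_cast hn
  have h3 := rpow_sub_tangent_le (s := α + 1) (u := (k : ℝ) / n) (by linarith) (by positivity)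
  set u := (k : ℝ) / n
  set h' := u ^ (α + 1) - 1 with hh'
  set m := powerSum b r 1 n k / (n : ℝ) ^ (α + 1)
  have hε : (0 : ℝ) < 1 / n := by positivity
  have hε1 : (1 : ℝ) / n ≤ 1 := by rw [div_le_one (by linarith)]; exact hn1
  set ε := (1 : ℝ) / n
  have h4 : h' ^ 2 ≤ 2 * K ^ 2 * (m ^ 2 + ε) := by
    have := pow_le_pow_left₀ (abs_nonneg _) h2 2
    rw [sq_abs] at this
    refine this.trans ?_
    have e : (K * (|m| + ε)) ^ 2 = K ^ 2 * (|m| + ε) ^ 2 := by ring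
    rw [e, mul_comm 2 (K ^ 2), mul_assoc]
    refine mul_le_mul_of_nonneg_left ?_ (by positivity)
    nlinarith [sq_nonneg (|m| - ε), sq_abs m]
  have h5 : C * (3 + |h'|) * ε ≤ 4 * C * ε + C * h' ^ 2 := by
    have : |h'| ≤ 1 + h' ^ 2 := by nlinarith [sq_nonneg (|h'| - 1), sq_abs h']
    have a1 : C * (3 + |h'|) * ε ≤ C * (4 + h' ^ 2) * ε :=
      mul_le_mul_of_nonneg_right (mul_le_mul_of_nonneg_left (by linarith) hC) hε.le
    have a2 : C * h' ^ 2 * ε ≤ C * h' ^ 2 := mul_le_of_le_one_right (by positivity) hε1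
    linarith
  have h6 : |L * (u - 1) - κ * h'| ≤ κ * (4 * (α + 1)) * h' ^ 2 := by
    have e : L * (u - 1) - κ * h' = -(κ * (h' - (α + 1) * (u - 1))) := by
      rw [hκ]; field_simp; ring
    rw [e, abs_neg, abs_mul, abs_of_pos hκ0, mul_assoc]
    exact mul_le_mul_of_nonneg_left h3 hκ0.le
  have e : m + L * (u - 1) = (m + κ * h') + (L * (u - 1) - κ * h') := by ring
  rw [e]
  refine (abs_add_le _ _).trans ?_
  have h7 : (C + κ * (4 * (α + 1))) * h' ^ 2
      ≤ (C + κ * (4 * (α + 1))) * (2 * K ^ 2 * (m ^ 2 + ε)) :=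
    mul_le_mul_of_nonneg_left h4 (by positivity)
  nlinarith [mul_nonneg hC (sq_nonneg m)]

lemma scaled_powerSum_two_approx (hα : 0 < α) (hL : 0 < L) (hb : RateAsymp α L b)
    (hr : RateAsymp α L r) :
    ∃ C : ℝ, 0 ≤ C ∧ ∃ n₀ : ℕ, ∀ n k : ℕ, 1 ≤ n → n₀ ≤ n →
      |powerSum b r 2 n k / (n : ℝ) ^ (2 * α + 1) - 2 * (L ^ 2 / (2 * α + 1))|
        ≤ C * (|powerSum b r 1 n k / (n : ℝ) ^ (α + 1)|
          + (powerSum b r 1 n k / (n : ℝ) ^ (α + 1)) ^ 2 + 1 / n) := by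
  obtain ⟨C1, hC1, h1⟩ := hb.sum_inv_sq hα hL
  obtain ⟨C2, hC2, h2⟩ := hr.sum_inv_sq hα hL
  obtain ⟨K, hK, n₀, hK'⟩ := abs_ratio_rpow_sub_one_le hα hL hb hr
  set κ := L ^ 2 / (2 * α + 1) with hκ
  have hκ0 : 0 < κ := by positivity
  refine ⟨C1 + 3 * C2 + 2 * κ * K + (2 * C2 + κ) * (2 * K ^ 2), by positivity, n₀,
    fun n k hn hn0 => ?_⟩
  have h1 := h1 n
  have h2 := h2 k
  have hK' := hK' n k hn hn0
  have hn1 : (1 : ℝ) ≤ n := by exact_mod_cast hn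
  have hn0 : (0 : ℝ) < n := by linarith
  rw [natCast_rpow_div hn (2 * α + 1), natCast_rpow_div hn (2 * α)] at h2
  have hu : 0 ≤ (k : ℝ) / n := by positivity
  have h3 := abs_rpow_sub_one_le hα hu
  set u := (k : ℝ) / n
  have h4 := rpow_le_one_add_pow (α := α) (s := 2 * α) 2 (by positivity)
    (by push_cast; linarith) hu
  set h' := u ^ (α + 1) - 1 with hh'
  have hh : u ^ (α + 1) = 1 + h' := by ring
  rw [hh] at h4
  set m := powerSum b r 1 n k / (n : ℝ) ^ (α + 1)
  have hN : 0 < (n : ℝ) ^ (2 * α) := by positivity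
  have hN1 : (n : ℝ) ^ (2 * α + 1) = (n : ℝ) ^ (2 * α) * n := Real.rpow_add_one hn0.ne' _
  have hε : (0 : ℝ) < 1 / n := by positivity
  have hε1 : (1 : ℝ) / n ≤ 1 := by rw [div_le_one (by linarith)]; exact hn1
  have e : powerSum b r 2 n k / (n : ℝ) ^ (2 * α + 1) - 2 * κ
      = ((∑ j ∈ Finset.range n, ((b j)⁻¹) ^ 2 - L ^ 2 * ((n : ℝ) ^ (2 * α + 1) / (2 * α + 1)))
        + (∑ j ∈ Finset.range k, ((r j)⁻¹) ^ 2
          - L ^ 2 * (u ^ (2 * α + 1) * (n : ℝ) ^ (2 * α + 1) / (2 * α + 1))))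
          / (n : ℝ) ^ (2 * α + 1) + κ * (u ^ (2 * α + 1) - 1) := by
    have : (n : ℝ) ^ (2 * α + 1) ≠ 0 := by positivity
    have : 2 * α + 1 ≠ 0 := by linarith
    simp only [powerSum, neg_sq, hκ]
    field_simp
    ring
  rw [e]
  refine (abs_add_le _ _).trans ?_
  have f1 : |((∑ j ∈ Finset.range n, ((b j)⁻¹) ^ 2
        - L ^ 2 * ((n : ℝ) ^ (2 * α + 1) / (2 * α + 1)))
        + (∑ j ∈ Finset.range k, ((r j)⁻¹) ^ 2
          - L ^ 2 * (u ^ (2 * α + 1) * (n : ℝ) ^ (2 * α + 1) / (2 * α + 1))))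
          / (n : ℝ) ^ (2 * α + 1)| ≤ (C1 + C2 * u ^ (2 * α)) * (1 / n) := by
    rw [abs_div, abs_of_pos (by positivity : 0 < (n : ℝ) ^ (2 * α + 1)),
      div_le_iff₀ (by positivity), hN1]
    rw [hN1] at h1 h2
    refine (abs_add_le _ _).trans ((add_le_add h1 h2).trans (le_of_eq ?_))
    field_simp
  have f2 : |κ * (u ^ (2 * α + 1) - 1)| ≤ κ * (2 * |h'| + h' ^ 2) := by
    rw [abs_mul, abs_of_pos hκ0]
    exact mul_le_mul_of_nonneg_left h3 hκ0.le
  set ε := (1 : ℝ) / n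
  have f3 : h' ^ 2 ≤ 2 * K ^ 2 * (m ^ 2 + ε) := by
    have := pow_le_pow_left₀ (abs_nonneg _) hK' 2
    rw [sq_abs] at this
    refine this.trans ?_
    have e : (K * (|m| + ε)) ^ 2 = K ^ 2 * (|m| + ε) ^ 2 := by ring
    rw [e, mul_comm 2 (K ^ 2), mul_assoc]
    refine mul_le_mul_of_nonneg_left ?_ (by positivity)
    nlinarith [sq_nonneg (|m| - ε), sq_abs m]
  have f4 : (C1 + C2 * u ^ (2 * α)) * ε ≤ (C1 + 3 * C2) * ε + 2 * C2 * h' ^ 2 := by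
    have a0 : u ^ (2 * α) ≤ 3 + 2 * h' ^ 2 := by nlinarith [sq_nonneg (h' - 1)]
    have a1 : (C1 + C2 * u ^ (2 * α)) * ε ≤ (C1 + C2 * (3 + 2 * h' ^ 2)) * ε := by gcongr
    have a2 : 2 * C2 * h' ^ 2 * ε ≤ 2 * C2 * h' ^ 2 := mul_le_of_le_one_right (by positivity) hε1
    linarith
  have f5 : (2 * C2 + κ) * h' ^ 2 ≤ (2 * C2 + κ) * (2 * K ^ 2) * (m ^ 2 + ε) := by
    rw [mul_assoc]; exact mul_le_mul_of_nonneg_left f3 (by positivity)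
  have f6 : 2 * κ * |h'| ≤ 2 * κ * K * (|m| + ε) := by
    rw [mul_assoc (2 * κ)]; exact mul_le_mul_of_nonneg_left hK' (by positivity)
  have f7 : 0 ≤ (C1 + 3 * C2) * (|m| + m ^ 2) := by positivity
  have f8 : 0 ≤ 2 * κ * K * m ^ 2 := by positivity
  have f9 : 0 ≤ (2 * C2 + κ) * (2 * K ^ 2) * |m| := by positivity
  linarith

lemma scaled_powerSum_le (hα : 0 < α) (hL : 0 < L) (hb : RateAsymp α L b)
    (hr : RateAsymp α L r) {p : ℕ} (hp : 1 ≤ p) :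
    ∃ C : ℝ, 0 ≤ C ∧ ∃ n₀ : ℕ, ∀ n k : ℕ, 1 ≤ n → n₀ ≤ n →
      |powerSum b r p n k / (n : ℝ) ^ (p * α + 1)|
        ≤ C * (1 + |powerSum b r 1 n k / (n : ℝ) ^ (α + 1)| ^ p) := by
  obtain ⟨C1, hC1, h1⟩ := hb.sum_inv_pow_le hα hL p
  obtain ⟨C2, hC2, h2⟩ := hr.sum_inv_pow_le hα hL p
  obtain ⟨K, hK, n₀, hK'⟩ := abs_ratio_rpow_sub_one_le hα hL hb hr
  refine ⟨C1 + C2 * (1 + 2 ^ (p - 1) * ((1 + K) ^ p + K ^ p)), by positivity, n₀,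
    fun n k hn hn0 => ?_⟩
  have h1 := h1 n
  have h2 := h2 k
  have hK' := hK' n k hn hn0
  have hn1 : (1 : ℝ) ≤ n := by exact_mod_cast hn
  have hn0 : (0 : ℝ) < n := by linarith
  rw [natCast_rpow_div hn] at h2
  have hu : 0 ≤ (k : ℝ) / n := by positivity
  set u := (k : ℝ) / n
  have hp1 : (1 : ℝ) ≤ p := by exact_mod_cast hp
  have h4 := rpow_le_one_add_pow (α := α) (s := p * α + 1) p (by positivity) (by linarith) hu
  set m := powerSum b r 1 n k / (n : ℝ) ^ (α + 1)
  have hε1 : (1 : ℝ) / n ≤ 1 := by rw [div_le_one (by linarith)]; exact hn1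
  have h5 : u ^ (α + 1) ≤ (1 + K) + K * |m| := by
    nlinarith [le_abs_self (u ^ (α + 1) - 1), mul_le_mul_of_nonneg_left hε1 hK]
  have h6 : (u ^ (α + 1)) ^ p ≤ 2 ^ (p - 1) * ((1 + K) ^ p + K ^ p * |m| ^ p) := by
    refine (pow_le_pow_left₀ (by positivity) h5 p).trans ?_
    rw [← mul_pow]
    exact add_pow_le (by positivity) (by positivity) p
  rw [abs_div, abs_of_pos (by positivity : 0 < (n : ℝ) ^ (p * α + 1)), div_le_iff₀ (by positivity)]
  have h7 : |powerSum b r p n k| ≤ ∑ j ∈ Finset.range n, |(b j)⁻¹| ^ p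
      + ∑ j ∈ Finset.range k, |(r j)⁻¹| ^ p := by
    refine (abs_add_le _ _).trans (add_le_add ?_ ?_)
    · exact (Finset.abs_sum_le_sum_abs _ _).trans (by simp [abs_pow])
    · exact (Finset.abs_sum_le_sum_abs _ _).trans (by simp [abs_pow])
  refine h7.trans ((add_le_add h1 h2).trans ?_)
  rw [← mul_assoc, ← add_mul]
  refine mul_le_mul_of_nonneg_right ?_ (by positivity)
  have h8 : C2 * u ^ (p * α + 1) ≤ C2 * (1 + 2 ^ (p - 1) * ((1 + K) ^ p + K ^ p * |m| ^ p)) := by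
    gcongr; linarith
  have h9 : 0 ≤ C1 * |m| ^ p := by positivity
  have h10 : 0 ≤ C2 * |m| ^ p := by positivity
  have h11 : 0 ≤ C2 * (2 ^ (p - 1) * ((1 + K) ^ p)) * |m| ^ p := by positivity
  have h12 : 0 ≤ C2 * (2 ^ (p - 1) * (K ^ p)) := by positivity
  linarith

end Deterministic

/-- Functions on `ℕ` of at most polynomial growth. -/
def PolyBdd (g : ℕ → ℝ) : Prop :=
  ∃ (C : ℝ) (e : ℕ), 0 ≤ C ∧ ∀ k : ℕ, |g k| ≤ C * ((k : ℝ) + 1) ^ e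

namespace PolyBdd

variable {f g : ℕ → ℝ}

lemma const (c : ℝ) : PolyBdd fun _ => c := ⟨|c|, 0, abs_nonneg _, fun k => by simp⟩

lemma natCast : PolyBdd fun k => (k : ℝ) :=
  ⟨1, 1, zero_le_one, fun k => by rw [abs_of_nonneg k.cast_nonneg]; linarith⟩

lemma add (hf : PolyBdd f) (hg : PolyBdd g) : PolyBdd fun k => f k + g k := by
  obtain ⟨C, e, hC, h⟩ := hf
  obtain ⟨C', e', hC', h'⟩ := hg
  refine ⟨C + C', e + e', by positivity, fun k => (abs_add_le _ _).trans ?_⟩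
  have hk : (1 : ℝ) ≤ (k : ℝ) + 1 := by
    linarith [k.cast_nonneg (α := ℝ)]
  have h1 : ((k : ℝ) + 1) ^ e ≤ ((k : ℝ) + 1) ^ (e + e') := pow_le_pow_right₀ hk (by omega)
  have h2 : ((k : ℝ) + 1) ^ e' ≤ ((k : ℝ) + 1) ^ (e + e') := pow_le_pow_right₀ hk (by omega)
  rw [add_mul]
  exact add_le_add ((h k).trans (mul_le_mul_of_nonneg_left h1 hC))
    ((h' k).trans (mul_le_mul_of_nonneg_left h2 hC'))

lemma mul (hf : PolyBdd f) (hg : PolyBdd g) : PolyBdd fun k => f k * g k := by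
  obtain ⟨C, e, hC, h⟩ := hf
  obtain ⟨C', e', hC', h'⟩ := hg
  refine ⟨C * C', e + e', by positivity, fun k => ?_⟩
  rw [abs_mul, pow_add, mul_mul_mul_comm]
  exact mul_le_mul (h k) (h' k) (abs_nonneg _) (by positivity)

lemma neg (hf : PolyBdd f) : PolyBdd fun k => -f k := by
  obtain ⟨C, e, hC, h⟩ := hf
  exact ⟨C, e, hC, fun k => by rw [abs_neg]; exact h k⟩

lemma abs (hf : PolyBdd f) : PolyBdd fun k => |f k| := by
  obtain ⟨C, e, hC, h⟩ := hf
  exact ⟨C, e, hC, fun k => by rw [abs_abs]; exact h k⟩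

lemma sub (hf : PolyBdd f) (hg : PolyBdd g) : PolyBdd fun k => f k - g k := by
  simpa only [sub_eq_add_neg] using hf.add hg.neg

lemma pow (hf : PolyBdd f) (m : ℕ) : PolyBdd fun k => f k ^ m := by
  induction m with
  | zero => simpa using const 1
  | succ m ih => simpa only [pow_succ] using ih.mul hf

lemma sum_range (hf : PolyBdd f) : PolyBdd fun k => ∑ j ∈ Finset.range k, f j := by
  obtain ⟨C, e, hC, h⟩ := hf
  refine ⟨C, e + 1, hC, fun k => ?_⟩
  calc |∑ j ∈ Finset.range k, f j| ≤ ∑ j ∈ Finset.range k, C * ((k : ℝ) + 1) ^ e := by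
        refine (Finset.abs_sum_le_sum_abs _ _).trans (Finset.sum_le_sum fun j hj => ?_)
        refine (h j).trans ?_
        have : (j : ℝ) ≤ k := by exact_mod_cast (Finset.mem_range.1 hj).le
        gcongr
    _ = (k : ℝ) * (C * ((k : ℝ) + 1) ^ e) := by simp
    _ ≤ ((k : ℝ) + 1) * (C * ((k : ℝ) + 1) ^ e) := by gcongr; linarith
    _ = _ := by ring

lemma div_two_pow_tendsto (hf : PolyBdd f) : Tendsto (fun k => f k / 2 ^ k) atTop (nhds 0) := by
  obtain ⟨C, e, hC, h⟩ := hf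
  have h1 := (tendsto_pow_const_div_const_pow_of_one_lt e (one_lt_two : (1 : ℝ) < 2)).comp
    (tendsto_add_atTop_nat 1)
  have h2 : Tendsto (fun k : ℕ => (2 * C) * (((k + 1 : ℕ) : ℝ) ^ e / 2 ^ (k + 1))) atTop (nhds 0) := by
    simpa using h1.const_mul (2 * C)
  refine squeeze_zero_norm (fun k => ?_) h2
  rw [Real.norm_eq_abs, abs_div, abs_of_pos (by positivity : (0 : ℝ) < 2 ^ k)]
  push_cast
  rw [pow_succ (2 : ℝ), mul_div_assoc']
  rw [div_le_div_iff₀ (by positivity) (by positivity)]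
  have := mul_le_mul_of_nonneg_right (h k) (by positivity : (0 : ℝ) ≤ 2 ^ k * 2)
  linarith

lemma le_two_pow (hf : PolyBdd f) : ∃ C : ℝ, ∀ k, |f k| ≤ C * 2 ^ k := by
  obtain ⟨C, hC⟩ := hf.div_two_pow_tendsto.abs.bddAbove_range
  refine ⟨C, fun k => ?_⟩
  have := hC ⟨k, rfl⟩
  simp only [abs_div] at this
  rwa [abs_of_pos (by positivity : (0 : ℝ) < 2 ^ k), div_le_iff₀ (by positivity)] at this

end PolyBdd

lemma RateAsymp.polyBdd_inv {α L : ℝ} {b : ℕ → ℝ} (hα : 0 < α) (hL : 0 < L)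
    (h : RateAsymp α L b) : PolyBdd fun j => (b j)⁻¹ := by
  obtain ⟨C, hC, hb⟩ := h.inv_le hα hL
  refine ⟨C, ⌈α⌉₊, hC, fun k => (hb k).trans ?_⟩
  have : (0 : ℝ) ≤ k := k.cast_nonneg
  rw [← Real.rpow_natCast]
  exact mul_le_mul_of_nonneg_left
    (Real.rpow_le_rpow_of_exponent_le (by linarith) (Nat.le_ceil α)) hC

lemma RateAsymp.tendsto_inv {α L : ℝ} {b : ℕ → ℝ} (hα : 0 < α) (hL : 0 < L)
    (h : RateAsymp α L b) : Tendsto (fun j => (b j)⁻¹) atTop atTop := by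
  obtain ⟨C, hC, hb⟩ := h
  have hT : Tendsto (fun j : ℕ => (j : ℝ) ^ (α - 1) * (L * j - C * 2 ^ α)) atTop atTop := by
    have h1 : Tendsto (fun j : ℕ => (j : ℝ) ^ α) atTop atTop :=
      (tendsto_rpow_atTop hα).comp tendsto_natCast_atTop_atTop
    have h2 : Tendsto (fun j : ℕ => L - C * 2 ^ α / (j : ℝ)) atTop (nhds L) := by
      simpa using (tendsto_const_nhds (x := L)).sub
        (tendsto_const_nhds.div_atTop tendsto_natCast_atTop_atTop)
    refine (h1.atTop_mul_pos hL h2).congr' ?_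
    filter_upwards [eventually_ge_atTop 1] with j hj
    have hj : (0 : ℝ) < j := by exact_mod_cast hj
    rw [Real.rpow_sub_one hj.ne']; field_simp
  refine tendsto_atTop_mono' _ ?_ hT
  filter_upwards [eventually_ge_atTop 1] with j hj
  have hj : (1 : ℝ) ≤ j := by exact_mod_cast hj
  have h1 := (abs_le.1 (hb j)).1
  have h2 : ((j : ℝ) + 1) ^ (α - 1) ≤ 2 ^ α * (j : ℝ) ^ (α - 1) := by
    have hp : 0 < (j : ℝ) ^ (α - 1) := by positivity
    rcases le_total 1 α with h | h
    · calc ((j : ℝ) + 1) ^ (α - 1) ≤ (2 * j) ^ (α - 1) :=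
            Real.rpow_le_rpow (by linarith) (by linarith) (by linarith)
        _ = 2 ^ (α - 1) * (j : ℝ) ^ (α - 1) := Real.mul_rpow (by norm_num) (by linarith)
        _ ≤ _ := by
          gcongr
          · norm_num
          · linarith
    · calc ((j : ℝ) + 1) ^ (α - 1) ≤ (j : ℝ) ^ (α - 1) :=
            Real.rpow_le_rpow_of_nonpos (by linarith) (by linarith) (by linarith)
        _ ≤ _ := le_mul_of_one_le_left hp.le (Real.one_le_rpow (by norm_num) hα.le)
  have h3 : (j : ℝ) ^ α = (j : ℝ) ^ (α - 1) * j := by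
    rw [← Real.rpow_add_one (by linarith)]; congr 1; ring
  have h4 := mul_le_mul_of_nonneg_left h2 hC
  rw [h3] at h1
  linarith

lemma polyBdd_powerSum {b r : ℕ → ℝ} (hr : PolyBdd fun j => (r j)⁻¹) (m i : ℕ) :
    PolyBdd (powerSum b r m i) :=
  (PolyBdd.const _).add (hr.neg.pow m).sum_range

/-- Functions of the urn's state preserved in mean by one draw. -/
def UrnHarmonic (b r : ℕ → ℝ) (f : ℕ → ℕ → ℝ) : Prop :=
  ∀ i k, b i / (b i + r k) * f (i + 1) k + r k / (b i + r k) * f i (k + 1) = f i k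

lemma powerSum_succ_blue (b r : ℕ → ℝ) (m i k : ℕ) :
    powerSum b r m (i + 1) k = powerSum b r m i k + ((b i)⁻¹) ^ m := by
  simp only [powerSum, Finset.sum_range_succ]; ring

lemma powerSum_succ_red (b r : ℕ → ℝ) (m i k : ℕ) :
    powerSum b r m i (k + 1) = powerSum b r m i k + (-(r k)⁻¹) ^ m := by
  simp only [powerSum, Finset.sum_range_succ]; ring

section Harmonic

variable {b r : ℕ → ℝ} (hb : ∀ i, 0 < b i) (hr : ∀ i, 0 < r i)
include hb hr

lemma urnHarmonic_one : UrnHarmonic b r fun _ _ => 1 := fun i k => by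
  have := hb i; have := hr k; field_simp

lemma urnHarmonic_powerSum_one : UrnHarmonic b r (powerSum b r 1) := fun i k => by
  have := hb i; have := hr k
  rw [powerSum_succ_blue, powerSum_succ_red]; field_simp; ring

lemma urnHarmonic_second : UrnHarmonic b r fun i k =>
    powerSum b r 1 i k ^ 2 - powerSum b r 2 i k := fun i k => by
  have := hb i; have := hr k
  simp only [powerSum_succ_blue, powerSum_succ_red]; field_simp; ring

/-- The fourth elementary symmetric polynomial, expressed through power sums. -/
lemma urnHarmonic_fourth : UrnHarmonic b r fun i k =>
    powerSum b r 1 i k ^ 4 - 6 * powerSum b r 1 i k ^ 2 * powerSum b r 2 i k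
      + 3 * powerSum b r 2 i k ^ 2 + 8 * powerSum b r 1 i k * powerSum b r 3 i k
      - 6 * powerSum b r 4 i k := fun i k => by
  have := hb i; have := hr k
  simp only [powerSum_succ_blue, powerSum_succ_red]; field_simp; ring

/-- An exponential-type harmonic function. -/
lemma urnHarmonic_prod (θ : ℝ) : UrnHarmonic b r fun i k =>
    (∏ j ∈ Finset.range i, (1 - θ * (b j)⁻¹)) * ∏ j ∈ Finset.range k, (1 + θ * (r j)⁻¹) :=
  fun i k => by
  have := hb i; have := hr k
  simp only [Finset.prod_range_succ]; field_simp; ring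

end Harmonic

/-- The probabilities of reaching `(i, k)` by a red draw, in terms of those by a blue draw. -/
noncomputable def redFlow (b r : ℕ → ℝ) (i : ℕ) (q : ℕ → ℝ) : ℕ → ℝ
  | 0 => 0
  | k + 1 => r k / (b i + r k) * (q k + redFlow b r i q k)

/-- The probabilities of reaching `(i, k)` by a blue draw (or of starting there). -/
noncomputable def blueFlow (b r : ℕ → ℝ) : ℕ → ℕ → ℝ
  | 0 => Pi.single 0 1
  | i + 1 => fun k =>
    b i / (b i + r k) * (blueFlow b r i k + redFlow b r i (blueFlow b r i) k)

section Flow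

variable {b r : ℕ → ℝ}

lemma redFlow_nonneg (hb : ∀ i, 0 < b i) (hr : ∀ i, 0 < r i) (i : ℕ) {q : ℕ → ℝ}
    (hq : ∀ k, 0 ≤ q k) (k : ℕ) : 0 ≤ redFlow b r i q k := by
  induction k with
  | zero => exact le_rfl
  | succ k ih =>
    have := hb i; have := hr k; have := hq k
    simp only [redFlow]; positivity

lemma blueFlow_nonneg (hb : ∀ i, 0 < b i) (hr : ∀ i, 0 < r i) (i k : ℕ) :
    0 ≤ blueFlow b r i k := by
  induction i generalizing k with
  | zero => simp only [blueFlow, Pi.single_apply]; split_ifs <;> norm_num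
  | succ i ih =>
    have := hb i; have := hr k; have := ih k; have := redFlow_nonneg hb hr i ih k
    simp only [blueFlow]; positivity

/-- Conservation of a harmonic function along the `i`-th column. -/
lemma flow_conservation {f : ℕ → ℕ → ℝ} (hf : UrnHarmonic b r f) (i K : ℕ) :
    ∑ k ∈ Finset.range K, blueFlow b r (i + 1) k * f (i + 1) k
      + redFlow b r i (blueFlow b r i) K * f i K
      = ∑ k ∈ Finset.range K, blueFlow b r i k * f i k := by
  induction K with
  | zero => simp [redFlow]
  | succ K ih =>
    rw [Finset.sum_range_succ, Finset.sum_range_succ, ← ih]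
    have h := hf i K
    simp only [blueFlow, redFlow]
    rw [show ∀ x : ℝ, x + (blueFlow b r i K * f i K)
      = x + ((blueFlow b r i K + redFlow b r i (blueFlow b r i) K) * f i K)
        - redFlow b r i (blueFlow b r i) K * f i K by intro x; ring, ← h]
    ring

/-- The blue entry and red exit probabilities of a column have exponential tails. -/
lemma flow_two_pow_bound (hb : ∀ i, 0 < b i) (hr : ∀ i, 0 < r i)
    (hT : Tendsto (fun j => (r j)⁻¹) atTop atTop) (n : ℕ) :
    ∃ C : ℝ, ∀ K, ∑ k ∈ Finset.range K, blueFlow b r n k * 2 ^ k ≤ C ∧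
      redFlow b r n (blueFlow b r n) K * 2 ^ K ≤ C := by
  obtain ⟨θ, hθ, hθb⟩ : ∃ θ : ℝ, 0 < θ ∧ ∀ i ≤ n, θ * (b i)⁻¹ < 1 := by
    obtain ⟨i₀, -, hi₀⟩ := Finset.exists_min_image (Finset.range (n + 1)) b ⟨0, by simp⟩
    refine ⟨b i₀ / 2, half_pos (hb _), fun i hi => ?_⟩
    rw [← div_eq_mul_inv, div_lt_one (hb i)]
    have := hi₀ i (Finset.mem_range.2 (by omega))
    linarith [hb i₀]
  set X : ℕ → ℝ := fun i => ∏ j ∈ Finset.range i, (1 - θ * (b j)⁻¹) with hX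
  set Y : ℕ → ℝ := fun k => ∏ j ∈ Finset.range k, (1 + θ * (r j)⁻¹) with hY
  have hXpos : ∀ i ≤ n, 0 < X i := fun i hi => Finset.prod_pos fun j hj => by
    have := hθb j (by have := Finset.mem_range.1 hj
                      omega)
    linarith
  have hYpos : ∀ k, 0 < Y k := fun k => Finset.prod_pos fun j _ => by
    have := hr j; positivity
  have hH : UrnHarmonic b r fun i k => X i * Y k := urnHarmonic_prod hb hr θ
  have hsum : ∀ i ≤ n, ∀ K, ∑ k ∈ Finset.range K, blueFlow b r i k * (X i * Y k) ≤ 1 := by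
    intro i
    induction i with
    | zero =>
      intro _ K
      calc ∑ k ∈ Finset.range K, blueFlow b r 0 k * (X 0 * Y k)
          = ∑ k ∈ Finset.range K, if k = 0 then 1 else 0 := by
            refine Finset.sum_congr rfl fun k _ => ?_
            rcases eq_or_ne k 0 with rfl | h
            · simp [blueFlow, hX, hY]
            · simp [blueFlow, h]
        _ ≤ 1 := by
            rw [Finset.sum_ite_eq']; split_ifs <;> norm_num
    | succ i ih =>
      intro hi K
      refine le_trans ?_ (ih (by omega) K)
      rw [← flow_conservation hH i K]
      have h1 := redFlow_nonneg hb hr i (blueFlow_nonneg hb hr i) K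
      have h2 := hXpos i (by omega)
      have h3 := hYpos K
      have : 0 ≤ redFlow b r i (blueFlow b r i) K * (X i * Y K) := by positivity
      linarith
  obtain ⟨c, hc, hcY⟩ : ∃ c : ℝ, 0 < c ∧ ∀ k, c * 2 ^ k ≤ Y k := by
    obtain ⟨J, hJ⟩ := eventually_atTop.1 (hT.eventually_ge_atTop (1 / θ))
    refine ⟨1 / 2 ^ J, by positivity, fun k => ?_⟩
    rw [div_mul_eq_mul_div, one_mul, div_le_iff₀ (by positivity)]
    have hstep : ∀ j, (1 : ℝ) ≤ 1 + θ * (r j)⁻¹ := fun j => by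
      have := hr j
      have : 0 ≤ θ * (r j)⁻¹ := by positivity
      linarith
    induction k with
    | zero => simp [hY]; exact one_le_pow₀ one_le_two
    | succ k ih =>
      rcases lt_or_ge k J with hk | hk
      · have h1 : 1 ≤ Y (k + 1) := Finset.prod_induction _ (1 ≤ ·)
            (fun _ _ => one_le_mul_of_one_le_of_one_le) le_rfl fun j _ => hstep j
        have h2 : (2 : ℝ) ^ (k + 1) ≤ 2 ^ J := pow_le_pow_right₀ one_le_two hk
        nlinarith [(by positivity : (0 : ℝ) < 2 ^ J)]
      · have h1 : (2 : ℝ) ≤ 1 + θ * (r k)⁻¹ := by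
          have := hJ k hk
          rw [div_le_iff₀ hθ] at this; linarith
        have h2 : Y (k + 1) = Y k * (1 + θ * (r k)⁻¹) := Finset.prod_range_succ _ _
        rw [h2, pow_succ]
        calc (2 : ℝ) ^ k * 2 ≤ (Y k * 2 ^ J) * 2 := by gcongr
          _ ≤ (Y k * 2 ^ J) * (1 + θ * (r k)⁻¹) :=
            mul_le_mul_of_nonneg_left h1 (by have := hYpos k; positivity)
          _ = _ := by ring
  have hXn := hXpos n le_rfl
  refine ⟨1 / (X n * c), fun K => ⟨?_, ?_⟩⟩
  · rw [le_div_iff₀ (by positivity)]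
    refine le_trans ?_ (hsum n le_rfl K)
    rw [Finset.sum_mul]
    refine Finset.sum_le_sum fun k _ => ?_
    have := mul_le_mul_of_nonneg_left (hcY k)
      (mul_nonneg (blueFlow_nonneg hb hr n k) hXn.le)
    linarith
  · rw [le_div_iff₀ (by positivity)]
    refine le_trans ?_ (hsum n le_rfl K)
    rw [← flow_conservation hH n K]
    have h0 : 0 ≤ ∑ k ∈ Finset.range K, blueFlow b r (n + 1) k * (X (n + 1) * Y k) := by
      refine Finset.sum_nonneg fun k _ => ?_
      have h1 : 0 ≤ X (n + 1) := by
        rw [hX]; simp only [Finset.prod_range_succ]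
        have := hθb n le_rfl
        exact mul_nonneg hXn.le (by linarith)
      exact mul_nonneg (blueFlow_nonneg hb hr _ _) (mul_nonneg h1 (hYpos k).le)
    have := mul_le_mul_of_nonneg_left (hcY K)
      (mul_nonneg (redFlow_nonneg hb hr n (blueFlow_nonneg hb hr n) K) hXn.le)
    linarith

lemma summable_blueFlow_mul (hb : ∀ i, 0 < b i) (hr : ∀ i, 0 < r i)
    (hT : Tendsto (fun j => (r j)⁻¹) atTop atTop) (n : ℕ) {g : ℕ → ℝ} (hg : PolyBdd g) :
    Summable fun k => blueFlow b r n k * g k := by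
  obtain ⟨C, hC⟩ := flow_two_pow_bound hb hr hT n
  obtain ⟨C', hC'⟩ := hg.le_two_pow
  have h1 : Summable fun k => blueFlow b r n k * 2 ^ k :=
    summable_of_sum_range_le (c := C)
      (fun k => mul_nonneg (blueFlow_nonneg hb hr n k) (by positivity)) fun K => (hC K).1
  refine Summable.of_norm_bounded (h1.mul_left C') fun k => ?_
  rw [Real.norm_eq_abs, abs_mul, abs_of_nonneg (blueFlow_nonneg hb hr n k)]
  have := mul_le_mul_of_nonneg_left (hC' k) (blueFlow_nonneg hb hr n k)
  linarith

lemma hasSum_blueFlow_mul (hb : ∀ i, 0 < b i) (hr : ∀ i, 0 < r i)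
    (hT : Tendsto (fun j => (r j)⁻¹) atTop atTop) {f : ℕ → ℕ → ℝ} (hf : UrnHarmonic b r f)
    (hpf : ∀ i, PolyBdd (f i)) (n : ℕ) :
    HasSum (fun k => blueFlow b r n k * f n k) (f 0 0) := by
  induction n with
  | zero =>
    convert hasSum_single (f := fun k => blueFlow b r 0 k * f 0 k) 0 ?_ using 1
    · simp [blueFlow]
    · intro k hk; simp [blueFlow, hk]
  | succ n ih =>
    have hs := summable_blueFlow_mul hb hr hT (n + 1) (hpf (n + 1))
    refine (hs.hasSum_iff_tendsto_nat).2 ?_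
    have h0 : Tendsto (fun K => redFlow b r n (blueFlow b r n) K * f n K) atTop (nhds 0) := by
      obtain ⟨C, hC⟩ := flow_two_pow_bound hb hr hT n
      have h1 : Tendsto (fun K => C * |f n K / 2 ^ K|) atTop (nhds 0) := by
        simpa using (hpf n).div_two_pow_tendsto.abs.const_mul C
      refine squeeze_zero_norm (fun K => ?_) h1
      have h2 := redFlow_nonneg hb hr n (blueFlow_nonneg hb hr n) K
      rw [Real.norm_eq_abs, abs_mul, abs_of_nonneg h2, abs_div,
        abs_of_pos (by positivity : (0 : ℝ) < 2 ^ K)]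
      calc _ = (redFlow b r n (blueFlow b r n) K * 2 ^ K) * (|f n K| / 2 ^ K) := by
            field_simp
        _ ≤ _ := mul_le_mul_of_nonneg_right (hC K).2 (by positivity)
    have h1 := ih.tendsto_sum_nat.sub h0
    rw [sub_zero] at h1
    refine h1.congr fun K => ?_
    rw [← flow_conservation hf n K]; ring

end Flow

lemma integral_add_add_const {ν : Measure ℕ} [IsProbabilityMeasure ν] {f g : ℕ → ℝ}
    (hf : Integrable f ν) (hg : Integrable g ν) (c : ℝ) :
    ∫ k, (f k + g k + c) ∂ν = ∫ k, f k ∂ν + ∫ k, g k ∂ν + c := by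
  rw [integral_add (f := fun k => f k + g k) (hf.add hg) (integrable_const c),
    integral_add hf hg, integral_const]
  simp

lemma fourth_moment_pointwise {C V ε a v t w : ℝ} (hC : 0 ≤ C) (hV : 0 ≤ V) (hε0 : 0 < ε)
    (hε1 : ε ≤ 1) (hv : |v - V| ≤ C * (|a| + a ^ 2 + ε)) (ht : |t| ≤ C * (1 + |a| ^ 3))
    (hw : |w| ≤ C * (1 + |a| ^ 4)) :
    a ^ 4 ≤ (a ^ 4 - 6 * ε * a ^ 2 * v + 3 * ε ^ 2 * v ^ 2 + 8 * ε ^ 2 * a * t - 6 * ε ^ 3 * w)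
      + (6 * V + 40 * C) * (ε * a ^ 2 + ε * a ^ 4 + ε ^ 2) := by
  have hεε : ε ^ 2 ≤ ε := by nlinarith
  have hεεε : ε ^ 3 ≤ ε ^ 2 := pow_le_pow_of_le_one hε0.le hε1 (by norm_num)
  have ha1 : |a| ≤ 1 + a ^ 2 := by nlinarith [sq_nonneg (|a| - 1), sq_abs a]
  have ha4 : |a| * |a| ^ 3 = a ^ 4 := by
    rw [← pow_succ']; exact (by decide : Even 4).pow_abs a
  have ha4' : |a| ^ 4 = a ^ 4 := (by decide : Even 4).pow_abs a
  have hv' : v ≤ V + 2 * C + 2 * C * a ^ 2 := by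
    have := (abs_le.1 hv).2
    have h3 : C * (|a| + a ^ 2 + ε) ≤ C * ((1 + a ^ 2) + a ^ 2 + 1) := by gcongr
    linarith
  have g1 : 6 * ε * a ^ 2 * v ≤ ε * (6 * (V + 2 * C)) * a ^ 2 + ε * (12 * C) * a ^ 4 := by
    have := mul_le_mul_of_nonneg_left hv' (by positivity : 0 ≤ 6 * ε * a ^ 2)
    linarith
  have g2 : -(8 * ε ^ 2 * a * t) ≤ 8 * C * ε ^ 2 * (1 + a ^ 2 + a ^ 4) := by
    have h1 : -(a * t) ≤ |a| * |t| := by rw [← abs_mul]; exact neg_le_abs _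
    have h2 : |a| * |t| ≤ |a| * (C * (1 + |a| ^ 3)) :=
      mul_le_mul_of_nonneg_left ht (abs_nonneg _)
    have h3 : |a| * (C * (1 + |a| ^ 3)) = C * (|a| + a ^ 4) := by rw [← ha4]; ring
    have h4 : C * (|a| + a ^ 4) ≤ C * (1 + a ^ 2 + a ^ 4) := by gcongr
    have := mul_le_mul_of_nonneg_left (h1.trans (h2.trans (h3.le.trans h4)))
      (by positivity : 0 ≤ 8 * ε ^ 2)
    linarith
  have g3 : 6 * ε ^ 3 * w ≤ 6 * C * ε ^ 2 * (1 + a ^ 4) := by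
    have h1 : w ≤ C * (1 + a ^ 4) := by rw [← ha4']; exact (le_abs_self _).trans hw
    calc 6 * ε ^ 3 * w ≤ 6 * ε ^ 3 * (C * (1 + a ^ 4)) := by gcongr
      _ ≤ 6 * ε ^ 2 * (C * (1 + a ^ 4)) := by gcongr
      _ = _ := by ring
  have g4 : ε ^ 2 * (C * a ^ 2) ≤ ε * (C * a ^ 2) := by gcongr
  have g5 : ε ^ 2 * (C * a ^ 4) ≤ ε * (C * a ^ 4) := by gcongr
  have g6 : 0 ≤ 3 * ε ^ 2 * v ^ 2 := by positivity
  have g7 : 0 ≤ ε * (V * a ^ 4) := by positivity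
  have g8 : 0 ≤ ε * (C * a ^ 4) := by positivity
  have g9 : 0 ≤ ε * (C * a ^ 2) := by positivity
  have g10 : 0 ≤ ε ^ 2 * C := by positivity
  have g11 : 0 ≤ ε ^ 2 * V := by positivity
  linarith

lemma abs_integral_sq_sub_le {ν : Measure ℕ} {m x : ℕ → ℝ} {s : ℝ} (hs0 : 0 < s)
    (i2 : Integrable (fun k => m k ^ 2) ν) (ix2 : Integrable (fun k => x k ^ 2) ν)
    (id2 : Integrable (fun k => (m k + x k) ^ 2) ν) :
    |∫ k, x k ^ 2 ∂ν - ∫ k, m k ^ 2 ∂ν|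
      ≤ (s + 1) * ∫ k, (m k + x k) ^ 2 ∂ν + (∫ k, m k ^ 2 ∂ν) / s := by
  rw [← integral_sub ix2 i2]
  refine (abs_integral_le_integral_abs).trans ?_
  have h : ∫ k, |x k ^ 2 - m k ^ 2| ∂ν
      ≤ ∫ k, ((s + 1) * (m k + x k) ^ 2 + 1 / s * m k ^ 2) ∂ν := by
    refine integral_mono (ix2.sub i2).abs ((id2.const_mul _).add (i2.const_mul _)) fun k => ?_
    dsimp only
    set d := m k + x k with hd
    set a := m k
    have e : x k ^ 2 - a ^ 2 = d ^ 2 - 2 * (d * a) := by rw [hd]; ring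
    have q : ∀ σ : ℝ, σ ^ 2 = 1 → 2 * (σ * (d * a)) ≤ s * d ^ 2 + 1 / s * a ^ 2 := by
      intro σ hσ
      have h1 : 0 ≤ (s * d - σ * a) ^ 2 / s := by positivity
      have h2 : (s * d - σ * a) ^ 2 / s = s * d ^ 2 - 2 * (σ * (d * a)) + σ ^ 2 * (1 / s * a ^ 2) := by
        field_simp; ring
      rw [h2, hσ] at h1
      linarith
    have q1 := q 1 (by norm_num)
    have q2 := q (-1) (by norm_num)
    have q3 := sq_nonneg d
    rw [e, abs_le]
    constructor <;> linarith
  rw [integral_add (id2.const_mul _) (i2.const_mul _), integral_const_mul,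
    integral_const_mul] at h
  calc _ ≤ _ := h
    _ = _ := by ring

set_option maxHeartbeats 1000000 in
lemma scaled_variance_bound {C V : ℝ} (hC : 0 ≤ C) (hV : 0 ≤ V) :
    ∃ (C' : ℝ) (N : ℕ), ∀ n : ℕ, 1 ≤ n → N ≤ n → ∀ (ν : Measure ℕ) [IsProbabilityMeasure ν],
      (∀ g, PolyBdd g → Integrable g ν) → ∀ m v t w x : ℕ → ℝ,
      PolyBdd m → PolyBdd v → PolyBdd t → PolyBdd w → PolyBdd x →
      ∫ k, m k ∂ν = 0 → n * ∫ k, m k ^ 2 ∂ν = ∫ k, v k ∂ν →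
      ∫ k, (m k ^ 4 - 6 * (1 / n) * m k ^ 2 * v k + 3 * (1 / n) ^ 2 * v k ^ 2
        + 8 * (1 / n) ^ 2 * m k * t k - 6 * (1 / n) ^ 3 * w k) ∂ν = 0 →
      (∀ k, |m k + x k| ≤ C * (m k ^ 2 + 1 / n)) →
      (∀ k, |v k - V| ≤ C * (|m k| + m k ^ 2 + 1 / n)) →
      (∀ k, |t k| ≤ C * (1 + |m k| ^ 3)) → (∀ k, |w k| ≤ C * (1 + |m k| ^ 4)) →
      |n * variance x ν - V| ≤ C' / √n := by
  set K₁ := 2 * (V + 2 * C) with hK₁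
  set K₂ := 6 * V + 40 * C with hK₂
  set K₃ := 2 * K₂ * (K₁ + 1) with hK₃
  set K₄ := 2 * C ^ 2 * (K₃ + 1) with hK₄
  refine ⟨C * ((K₁ + 1) / 2 + K₁ + 1) + (2 * K₄ + K₁) + K₄, ⌈4 * C + 2 * K₂⌉₊, ?_⟩
  intro n hn hnN ν _ hInt m v t w x pm pv pt pw px Em E2 E4 hx hv ht hw
  have hn1 : (1 : ℝ) ≤ n := by exact_mod_cast hn
  have hn0 : (0 : ℝ) < n := by linarith
  have hnN' : 4 * C + 2 * K₂ ≤ n := Nat.ceil_le.1 hnN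
  have hK1 : 0 ≤ K₁ := by positivity
  have hK2 : 0 ≤ K₂ := by positivity
  have hK3 : 0 ≤ K₃ := by positivity
  have hK4 : 0 ≤ K₄ := by positivity
  set ε : ℝ := 1 / n with hε
  have hε0 : 0 < ε := by positivity
  have hnε : n * ε = 1 := by rw [hε]; field_simp
  have hε1 : ε ≤ 1 := by rw [hε, div_le_one hn0]; exact hn1
  set s : ℝ := √n with hs
  have hs0 : 0 < s := Real.sqrt_pos.2 hn0
  have hss : s * s = n := Real.mul_self_sqrt hn0.le
  have hs1 : 1 ≤ s := by rw [hs]; exact Real.one_le_sqrt.2 hn1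
  have i2 := hInt _ (pm.pow 2)
  have i4 := hInt _ (pm.pow 4)
  have iv := hInt _ pv
  have ia := hInt _ pm.abs
  have im := hInt _ pm
  have hc : ∀ c : ℝ, Integrable (fun _ : ℕ => c) ν := fun c => integrable_const c
  have Ec : ∀ c : ℝ, ∫ _ : ℕ, c ∂ν = c := fun c => by simp
  set A := ∫ k, m k ^ 2 ∂ν with hA
  set Q := ∫ k, m k ^ 4 ∂ν with hQ
  have hA0 : 0 ≤ A := integral_nonneg fun k => by positivity
  have Ea_s : ∫ k, |m k| ∂ν ≤ (s * A + 1 / s) / 2 := by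
    have h : ∫ k, |m k| ∂ν ≤ ∫ k, (s / 2 * m k ^ 2 + 1 / s / 2) ∂ν := by
      refine integral_mono ia ((i2.const_mul _).add (hc _)) fun k => ?_
      have h1 : 0 ≤ (s * |m k| - 1) ^ 2 / s := by positivity
      have h2 : (s * |m k| - 1) ^ 2 / s = s * |m k| ^ 2 - 2 * |m k| + 1 / s := by
        field_simp; ring
      rw [h2, sq_abs] at h1
      dsimp only
      linarith
    rw [integral_add (i2.const_mul _) (hc _), integral_const_mul, Ec] at h
    linarith
  have Ea_one : ∫ k, |m k| ∂ν ≤ (A + 1) / 2 := by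
    have h : ∫ k, |m k| ∂ν ≤ ∫ k, (1 / 2 * m k ^ 2 + 1 / 2) ∂ν := by
      refine integral_mono ia ((i2.const_mul _).add (hc _)) fun k => ?_
      dsimp only
      nlinarith [sq_nonneg (|m k| - 1), sq_abs (m k)]
    rw [integral_add (i2.const_mul _) (hc _), integral_const_mul, Ec] at h
    linarith
  have hvE : |n * A - V| ≤ C * (∫ k, |m k| ∂ν + A + ε) := by
    rw [E2]
    have h1 : ∫ k, v k ∂ν - V = ∫ k, (v k - V) ∂ν := by rw [integral_sub iv (hc _), Ec]
    rw [h1]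
    refine (abs_integral_le_integral_abs).trans ?_
    have h2 : ∫ k, |v k - V| ∂ν ≤ ∫ k, C * (|m k| + m k ^ 2 + ε) ∂ν :=
      integral_mono (iv.sub (hc _)).abs (((ia.add i2).add (hc _)).const_mul _) hv
    rwa [integral_const_mul, integral_add_add_const ia i2] at h2
  have hAn : A ≤ K₁ * ε := by
    have h1 : n * A ≤ V + C * ((A + 1) / 2 + A + 1) := by
      have := (abs_le.1 hvE).2
      have h3 : C * (∫ k, |m k| ∂ν + A + ε) ≤ C * ((A + 1) / 2 + A + 1) := by gcongr
      linarith
    have h2 : n * A ≤ K₁ := by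
      have h4 : 4 * C * A ≤ n * A := mul_le_mul_of_nonneg_right (by linarith) hA0
      have h5 : 0 ≤ C * A := mul_nonneg hC hA0
      linarith
    rw [hε, mul_one_div, le_div_iff₀ hn0]; linarith
  have hεs : ε = 1 / s * (1 / s) := by rw [hε, ← hss]; field_simp
  have h1s : 1 / s ≤ 1 := by rw [div_le_one hs0]; exact hs1
  have h1s0 : 0 < 1 / s := by positivity
  have hεs' : ε ≤ 1 / s := by rw [hεs]; exact mul_le_of_le_one_right h1s0.le h1s
  have hsA : s * A ≤ K₁ * (1 / s) := by
    calc s * A ≤ s * (K₁ * ε) := by gcongr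
      _ = K₁ * (1 / s) := by rw [hεs]; field_simp
  have hnA : |n * A - V| ≤ C * ((K₁ + 1) / 2 + K₁ + 1) * (1 / s) := by
    refine hvE.trans ?_
    rw [mul_assoc]
    refine mul_le_mul_of_nonneg_left ?_ hC
    have : A ≤ K₁ * (1 / s) := hAn.trans (by gcongr)
    linarith
  have hQ' : Q ≤ K₃ * ε ^ 2 := by
    have hF : PolyBdd fun k => m k ^ 4 - 6 * ε * m k ^ 2 * v k + 3 * ε ^ 2 * v k ^ 2
        + 8 * ε ^ 2 * m k * t k - 6 * ε ^ 3 * w k :=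
      ((((pm.pow 4).sub (((PolyBdd.const _).mul (pm.pow 2)).mul pv)).add
        ((PolyBdd.const _).mul (pv.pow 2))).add (((PolyBdd.const _).mul pm).mul pt)).sub
        ((PolyBdd.const _).mul pw)
    have iF := hInt _ hF
    have iR : Integrable (fun k => K₂ * (ε * m k ^ 2 + ε * m k ^ 4 + ε ^ 2)) ν :=
      (((i2.const_mul _).add (i4.const_mul _)).add (hc _)).const_mul _
    have h : Q ≤ ∫ k, ((m k ^ 4 - 6 * ε * m k ^ 2 * v k + 3 * ε ^ 2 * v k ^ 2
        + 8 * ε ^ 2 * m k * t k - 6 * ε ^ 3 * w k)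
        + K₂ * (ε * m k ^ 2 + ε * m k ^ 4 + ε ^ 2)) ∂ν := by
      refine integral_mono i4 (iF.add iR) fun k => ?_
      exact fourth_moment_pointwise hC hV hε0 hε1 (hv k) (ht k) (hw k)
    rw [integral_add iF iR, E4, integral_const_mul,
      integral_add_add_const (i2.const_mul _) (i4.const_mul _), integral_const_mul,
      integral_const_mul] at h
    have hQ0 : 0 ≤ Q := integral_nonneg fun k => by positivity
    have h1 : K₂ * (ε * Q) ≤ Q / 2 := by
      have : K₂ * ε ≤ 1 / 2 := by rw [hε, mul_one_div, div_le_iff₀ hn0]; linarith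
      have := mul_le_mul_of_nonneg_right this hQ0
      linarith
    have h2 : K₂ * (ε * A) ≤ K₂ * (K₁ * ε ^ 2) := by
      refine mul_le_mul_of_nonneg_left ?_ hK2
      calc ε * A ≤ ε * (K₁ * ε) := mul_le_mul_of_nonneg_left hAn hε0.le
        _ = K₁ * ε ^ 2 := by ring
    rw [hK₃]
    linarith
  have pd : PolyBdd fun k => m k + x k := pm.add px
  have id1 := hInt _ pd
  have id2 := hInt _ (pd.pow 2)
  set E := ∫ k, (m k + x k) ^ 2 ∂ν with hE
  have hE0 : 0 ≤ E := integral_nonneg fun k => by positivity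
  have hEb : E ≤ K₄ * ε ^ 2 := by
    have h : E ≤ ∫ k, 2 * C ^ 2 * (m k ^ 4 + ε ^ 2) ∂ν := by
      refine integral_mono id2 ((i4.add (hc _)).const_mul _) fun k => ?_
      dsimp only
      have h1 := pow_le_pow_left₀ (abs_nonneg _) (hx k) 2
      rw [sq_abs, mul_pow] at h1
      refine h1.trans ?_
      have h2 : (m k ^ 2 + ε) ^ 2 ≤ 2 * (m k ^ 4 + ε ^ 2) := by nlinarith [sq_nonneg (m k ^ 2 - ε)]
      have := mul_le_mul_of_nonneg_left h2 (sq_nonneg C)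
      linarith
    rw [integral_const_mul, integral_add i4 (hc _), Ec] at h
    rw [hK₄]
    have := mul_le_mul_of_nonneg_left hQ' (by positivity : 0 ≤ 2 * C ^ 2)
    linarith
  have ix := hInt _ px
  have ix2 := hInt _ (px.pow 2)
  have hmean : ∫ k, x k ∂ν = ∫ k, (m k + x k) ∂ν := by rw [integral_add im ix, Em, zero_add]
  have hmean2 : (∫ k, x k ∂ν) ^ 2 ≤ E := by
    rw [hmean]
    have hmem : MemLp (fun k => m k + x k) 2 ν :=
      (memLp_two_iff_integrable_sq id1.aestronglyMeasurable).2 id2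
    have := variance_nonneg (fun k => m k + x k) ν
    rw [variance_eq_sub hmem] at this
    simpa using this
  have hmemx : MemLp x 2 ν := (memLp_two_iff_integrable_sq ix.aestronglyMeasurable).2 ix2
  rw [variance_eq_sub hmemx]
  simp only [Pi.pow_apply]
  have hdiff := abs_integral_sq_sub_le hs0 i2 ix2 id2
  have hfin1 : n * ((s + 1) * E + A / s) ≤ (2 * K₄ + K₁) * (1 / s) := by
    have h1 : n * ((s + 1) * E) ≤ 2 * K₄ * (1 / s) := by
      calc n * ((s + 1) * E) ≤ n * ((2 * s) * (K₄ * ε ^ 2)) := by gcongr; linarith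
        _ = 2 * K₄ * (s * ε) := by rw [show n * ((2 * s) * (K₄ * ε ^ 2))
              = 2 * K₄ * (s * ε) * (n * ε) by ring, hnε, mul_one]
        _ = _ := by rw [hεs]; field_simp
    have h2 : n * (A / s) ≤ K₁ * (1 / s) := by
      calc n * (A / s) ≤ n * ((K₁ * ε) / s) := by gcongr
        _ = K₁ * (1 / s) * (n * ε) := by ring
        _ = _ := by rw [hnε, mul_one]
    linarith
  have hfin2 : n * (∫ k, x k ∂ν) ^ 2 ≤ K₄ * (1 / s) := by
    calc n * (∫ k, x k ∂ν) ^ 2 ≤ n * (K₄ * ε ^ 2) := by gcongr; exact hmean2.trans hEb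
      _ = K₄ * ε * (n * ε) := by ring
      _ ≤ K₄ * (1 / s) := by rw [hnε, mul_one]; gcongr
  have hsplit : n * (∫ k, x k ^ 2 ∂ν - (∫ k, x k ∂ν) ^ 2) - V
      = (n * A - V) + n * (∫ k, x k ^ 2 ∂ν - A) - n * (∫ k, x k ∂ν) ^ 2 := by ring
  have hdiff' : |n * (∫ k, x k ^ 2 ∂ν - A)| ≤ (2 * K₄ + K₁) * (1 / s) := by
    rw [abs_mul, abs_of_pos hn0]
    exact (mul_le_mul_of_nonneg_left hdiff hn0.le).trans hfin1
  rw [hsplit, ← mul_one_div]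
  refine (abs_sub _ _).trans ?_
  rw [abs_of_nonneg (by positivity : 0 ≤ n * (∫ k, x k ∂ν) ^ 2)]
  have := abs_add_le (n * A - V) (n * (∫ k, x k ^ 2 ∂ν - A))
  linarith

namespace Urn

variable {Ω : Type*} [MeasurableSpace Ω] {μ : Measure Ω} {b r : ℕ → ℝ} (U : Urn μ b r)

lemma Bl_add_Re (N : ℕ) (ω : Ω) : U.Bl N ω + U.Re N ω = N := by
  induction N with
  | zero => rw [U.init_Bl, U.init_Re]
  | succ N ih => rcases U.step N ω with ⟨h1, h2⟩ | ⟨h1, h2⟩ <;> omega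

lemma Bl_le (N : ℕ) (ω : Ω) : U.Bl N ω ≤ N := by
  have := U.Bl_add_Re N ω
  omega

lemma Bl_mono (ω : Ω) : Monotone fun N => U.Bl N ω :=
  monotone_nat_of_le_succ fun N => by rcases U.step N ω with ⟨h, -⟩ | ⟨h, -⟩ <;> omega

/-- The event that the urn passes through `(i, k)`. -/
def visit (i k : ℕ) : Set Ω := {ω | U.Bl (i + k) ω = i}

/-- The event that the urn passes through `(i, k)` and `(i + 1, k)`. -/
def blueStep (i k : ℕ) : Set Ω := {ω | U.Bl (i + k) ω = i ∧ U.Bl (i + k + 1) ω = i + 1}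

lemma measurableSet_visit (i k : ℕ) : MeasurableSet (U.visit i k) :=
  U.meas_Bl _ (measurableSet_singleton i)

lemma measurableSet_blueStep (i k : ℕ) : MeasurableSet (U.blueStep i k) :=
  (U.measurableSet_visit i k).inter (U.meas_Bl _ (measurableSet_singleton (i + 1)))

lemma blueStep_subset_visit (i k : ℕ) : U.blueStep i k ⊆ U.visit i k := fun _ h => h.1

lemma F_le (N : ℕ) : U.F N ≤ (inferInstance : MeasurableSpace Ω) :=
  iSup₂_le fun j _ => ((U.meas_Bl j).prodMk (U.meas_Re j)).comap_le

lemma measurableSet_F_visit (i k : ℕ) : MeasurableSet[U.F (i + k)] (U.visit i k) := by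
  have h : MeasurableSpace.comap (fun ω => (U.Bl (i + k) ω, U.Re (i + k) ω)) inferInstance
      ≤ U.F (i + k) :=
    le_iSup₂ (f := fun j (_ : j ∈ Set.Iic (i + k)) =>
      MeasurableSpace.comap (fun ω => (U.Bl j ω, U.Re j ω)) inferInstance) (i + k)
      (Set.mem_Iic.2 le_rfl)
  exact h _ ⟨{p | p.1 = i}, measurable_fst (measurableSet_singleton i), rfl⟩

lemma tau_succ_of_mem_blueStep {n : ℕ} : ∀ {N : ℕ} {ω : Ω},
    U.Bl N ω = n → U.Bl (N + 1) ω = n + 1 → U.tau (n + 1) ω = N + 1 := by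
  induction n with
  | zero =>
    intro N ω h0 h1
    refine le_antisymm (Nat.sInf_le ⟨Nat.succ_pos N, by rw [Nat.add_sub_cancel, h0, h1]⟩)
      (le_csInf ⟨N + 1, Nat.succ_pos N, by rw [Nat.add_sub_cancel, h0, h1]⟩ ?_)
    rintro t ⟨-, ht⟩
    by_contra! hlt
    have := U.Bl_mono ω (show t ≤ N by omega)
    dsimp only at this
    omega
  | succ n ih =>
    intro N ω h0 h1
    obtain ⟨M, hMN, hM0, hM1⟩ : ∃ M < N, U.Bl M ω = n ∧ U.Bl (M + 1) ω = n + 1 := by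
      clear h1
      induction N with
      | zero => rw [U.init_Bl] at h0; omega
      | succ N ihN =>
        rcases U.step N ω with ⟨h, -⟩ | ⟨h, -⟩
        · exact ⟨N, by omega, by omega, h0⟩
        · obtain ⟨M, hM, h2⟩ := ihN (by omega)
          exact ⟨M, by omega, h2⟩
    have hτ : U.tau (n + 1) ω = M + 1 := ih hM0 hM1
    have hmem : N + 1 ∈ {t : ℕ | U.tau (n + 1) ω < t ∧ U.Bl t ω = U.Bl (t - 1) ω + 1} :=
      ⟨by omega, by rw [Nat.add_sub_cancel, h0, h1]⟩
    refine le_antisymm (Nat.sInf_le hmem) (le_csInf ⟨_, hmem⟩ ?_)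
    rintro t ⟨ht, ht2⟩
    by_contra! hlt
    have h3 := U.Bl_mono ω (show t ≤ N by omega)
    have h4 := U.Bl_mono ω (show M + 1 ≤ t - 1 by omega)
    dsimp only at h3 h4
    omega

lemma Bl_tau_of_mem_blueStep {n k : ℕ} {ω : Ω} (h : ω ∈ U.blueStep n k) :
    U.Bl (U.tau (n + 1) ω) ω = n + 1 := by
  rw [U.tau_succ_of_mem_blueStep h.1 h.2]
  exact h.2

lemma Re_tau_of_mem_blueStep {n k : ℕ} {ω : Ω} (h : ω ∈ U.blueStep n k) :
    U.Re (U.tau (n + 1) ω) ω = k := by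
  have h1 := U.Bl_tau_of_mem_blueStep h
  have h2 := U.Bl_add_Re (U.tau (n + 1) ω) ω
  have h3 := U.tau_succ_of_mem_blueStep h.1 h.2
  omega

lemma pairwise_disjoint_blueStep (n : ℕ) : Pairwise (Function.onFun Disjoint (U.blueStep n)) :=
  fun _ _ hij => Set.disjoint_left.2 fun _ hi hj =>
    hij ((U.Re_tau_of_mem_blueStep hi).symm.trans (U.Re_tau_of_mem_blueStep hj))

lemma visit_zero_zero : U.visit 0 0 = Set.univ :=
  Set.eq_univ_of_forall fun ω => U.init_Bl ω

lemma visit_zero_succ (k : ℕ) : U.visit 0 (k + 1) = U.visit 0 k \ U.blueStep 0 k := by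
  ext ω
  simp only [visit, blueStep, Set.mem_sdiff, Set.mem_ofPred_eq, Nat.zero_add]
  rcases U.step k ω with ⟨h, -⟩ | ⟨h, -⟩ <;> omega

lemma visit_succ_zero (i : ℕ) : U.visit (i + 1) 0 = U.blueStep i 0 := by
  ext ω
  simp only [visit, blueStep, Set.mem_ofPred_eq, Nat.add_zero]
  have := U.Bl_le i ω
  rcases U.step i ω with ⟨h, -⟩ | ⟨h, -⟩ <;> omega

lemma visit_succ_succ (i k : ℕ) : U.visit (i + 1) (k + 1)
    = U.blueStep i (k + 1) ∪ U.visit (i + 1) k \ U.blueStep (i + 1) k := by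
  ext ω
  simp only [visit, blueStep, Set.mem_union, Set.mem_sdiff, Set.mem_ofPred_eq]
  have e1 : i + 1 + (k + 1) = i + 1 + k + 1 := by omega
  have e2 : i + (k + 1) = i + 1 + k := by omega
  rw [e1, e2]
  rcases U.step (i + 1 + k) ω with ⟨h, -⟩ | ⟨h, -⟩ <;> omega

lemma disjoint_visit_succ_succ (i k : ℕ) :
    Disjoint (U.blueStep i (k + 1)) (U.visit (i + 1) k \ U.blueStep (i + 1) k) := by
  refine Set.disjoint_left.2 fun ω h1 h2 => ?_
  have e1 : U.Bl (i + (k + 1)) ω = i := h1.1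
  have e2 : U.Bl (i + 1 + k) ω = i + 1 := h2.1
  rw [show i + (k + 1) = i + 1 + k by omega] at e1
  omega

section Probability

variable [IsProbabilityMeasure μ]

lemma measureReal_blueStep (i k : ℕ) :
    μ.real (U.blueStep i k) = b i / (b i + r k) * μ.real (U.visit i k) := by
  set f : Ω → ℝ := fun ω => if U.Bl (i + k + 1) ω = U.Bl (i + k) ω + 1 then (1 : ℝ) else 0 with hf
  have hS : MeasurableSet {ω | U.Bl (i + k + 1) ω = U.Bl (i + k) ω + 1} :=
    measurableSet_eq_fun (U.meas_Bl _) ((U.meas_Bl _).add_const 1)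
  have hfi : f = Set.indicator {ω | U.Bl (i + k + 1) ω = U.Bl (i + k) ω + 1} 1 := by
    ext ω; simp [hf, Set.indicator_apply]
  have hInt : Integrable f μ := by
    rw [hfi]; exact (integrable_const (1 : ℝ)).indicator hS
  have h1 := setIntegral_condExp (U.F_le (i + k)) hInt (U.measurableSet_F_visit i k)
  have h2 : ∫ ω in U.visit i k, (μ[f | U.F (i + k)]) ω ∂μ
      = ∫ ω in U.visit i k, b i / (b i + r k) ∂μ := by
    refine setIntegral_congr_ae (U.measurableSet_visit i k) ?_
    filter_upwards [U.markov (i + k)] with ω hω hv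
    have e1 : U.Bl (i + k) ω = i := hv
    have e2 : U.Re (i + k) ω = k := by
      have := U.Bl_add_Re (i + k) ω
      omega
    have h3 : (μ[f | U.F (i + k)]) ω
      = b (U.Bl (i + k) ω) / (b (U.Bl (i + k) ω) + r (U.Re (i + k) ω)) := hω
    rw [h3, e1, e2]
  rw [h2, hfi, setIntegral_indicator hS] at h1
  have h4 : U.visit i k ∩ {ω | U.Bl (i + k + 1) ω = U.Bl (i + k) ω + 1} = U.blueStep i k := by
    ext ω
    simp only [visit, blueStep, Set.mem_inter_iff, Set.mem_ofPred_eq]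
    omega
  rw [h4] at h1
  simp only [Pi.one_apply, setIntegral_const, smul_eq_mul, mul_one] at h1
  rw [← h1, mul_comm]

lemma measureReal_visit_diff (hb : ∀ i, 0 < b i) (hr : ∀ i, 0 < r i) (i k : ℕ) :
    μ.real (U.visit i k \ U.blueStep i k) = r k / (b i + r k) * μ.real (U.visit i k) := by
  rw [measureReal_sdiff (U.blueStep_subset_visit i k) (U.measurableSet_blueStep i k),
    measureReal_blueStep]
  have := hb i
  have := hr k
  field_simp
  ring

lemma measureReal_visit (hb : ∀ i, 0 < b i) (hr : ∀ i, 0 < r i) (i k : ℕ) :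
    μ.real (U.visit i k) = blueFlow b r i k + redFlow b r i (blueFlow b r i) k := by
  induction i generalizing k with
  | zero =>
    induction k with
    | zero => simp [visit_zero_zero, blueFlow, redFlow]
    | succ k ih =>
      rw [visit_zero_succ, U.measureReal_visit_diff hb hr, ih]
      simp [blueFlow, redFlow]
  | succ i ihi =>
    have hB : ∀ k, μ.real (U.blueStep i k) = blueFlow b r (i + 1) k := fun k => by
      rw [measureReal_blueStep, ihi]; rfl
    induction k with
    | zero => rw [visit_succ_zero, hB]; simp [redFlow]
    | succ k ih =>
      rw [visit_succ_succ, measureReal_union (U.disjoint_visit_succ_succ i k)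
        ((U.measurableSet_visit _ _).diff (U.measurableSet_blueStep _ _)), hB,
        U.measureReal_visit_diff hb hr, ih]
      rfl

lemma measureReal_blueStep_eq_blueFlow (hb : ∀ i, 0 < b i) (hr : ∀ i, 0 < r i) (n k : ℕ) :
    μ.real (U.blueStep n k) = blueFlow b r (n + 1) k := by
  rw [measureReal_blueStep, U.measureReal_visit hb hr]; rfl

variable (hb : ∀ i, 0 < b i) (hr : ∀ i, 0 < r i) (hT : Tendsto (fun j => (r j)⁻¹) atTop atTop)
include hb hr hT

lemma ae_exists_mem_blueStep (n : ℕ) : ∀ᵐ ω ∂μ, ω ∈ ⋃ k, U.blueStep n k := by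
  have hm := MeasurableSet.iUnion (U.measurableSet_blueStep n)
  refine (mem_ae_iff_prob_eq_one hm).2 ?_
  rw [measure_iUnion (U.pairwise_disjoint_blueStep n) (U.measurableSet_blueStep n)]
  have h := hasSum_blueFlow_mul hb hr hT (urnHarmonic_one hb hr)
    (fun _ => PolyBdd.const 1) (n + 1)
  simp only [mul_one] at h
  have h1 : ∀ k, μ (U.blueStep n k) = ENNReal.ofReal (blueFlow b r (n + 1) k) := fun k => by
    rw [← U.measureReal_blueStep_eq_blueFlow hb hr, ofReal_measureReal]
  simp_rw [h1]
  rw [← ENNReal.ofReal_tsum_of_nonneg (blueFlow_nonneg hb hr (n + 1)) h.summable, h.tsum_eq,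
    ENNReal.ofReal_one]

lemma aemeasurable_Re_tau (n : ℕ) : AEMeasurable (fun ω => U.Re (U.tau (n + 1) ω) ω) μ := by
  have h : AEMeasurable (fun ω => U.Re (U.tau (n + 1) ω) ω)
      (μ.restrict (⋃ k, U.blueStep n k)) := by
    refine aemeasurable_iUnion_iff.2 fun k => (aemeasurable_const (b := k)).congr ?_
    filter_upwards [ae_restrict_mem (U.measurableSet_blueStep n k)] with ω hω
    exact (U.Re_tau_of_mem_blueStep hω).symm
  generalize (fun ω => U.Re (U.tau (n + 1) ω) ω) = T at h ⊢
  rwa [Measure.restrict_eq_self_of_ae_mem (U.ae_exists_mem_blueStep hb hr hT n)] at h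

lemma map_Re_tau_singleton (n k : ℕ) :
    (μ.map fun ω => U.Re (U.tau (n + 1) ω) ω).real {k} = blueFlow b r (n + 1) k := by
  rw [map_measureReal_apply_of_aemeasurable (U.aemeasurable_Re_tau hb hr hT n)
    (measurableSet_singleton k), ← U.measureReal_blueStep_eq_blueFlow hb hr]
  refine measureReal_congr ?_
  filter_upwards [U.ae_exists_mem_blueStep hb hr hT n] with ω hω
  obtain ⟨j, hj⟩ := Set.mem_iUnion.1 hω
  refine propext ⟨fun h => ?_, fun h => U.Re_tau_of_mem_blueStep h⟩
  have h1 : U.Re (U.tau (n + 1) ω) ω = k := h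
  rw [U.Re_tau_of_mem_blueStep hj] at h1
  exact h1 ▸ hj

lemma D_tau_ae_eq (n : ℕ) : (fun ω => (U.D (U.tau (n + 1) ω) ω : ℝ))
    =ᵐ[μ] fun ω => (U.Re (U.tau (n + 1) ω) ω : ℝ) - ((n + 1 : ℕ) : ℝ) := by
  filter_upwards [U.ae_exists_mem_blueStep hb hr hT n] with ω hω
  obtain ⟨j, hj⟩ := Set.mem_iUnion.1 hω
  simp only [D, U.Bl_tau_of_mem_blueStep hj]
  push_cast
  rfl

lemma variance_D_tau (n : ℕ) : variance (fun ω => (U.D (U.tau (n + 1) ω) ω : ℝ)) μ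
    = variance (fun k : ℕ => (k : ℝ)) (μ.map fun ω => U.Re (U.tau (n + 1) ω) ω) := by
  have hm := U.aemeasurable_Re_tau hb hr hT n
  rw [variance_congr (U.D_tau_ae_eq hb hr hT n), variance_map (by fun_prop) hm,
    variance_sub_const]
  · rfl
  · exact (measurable_from_nat (f := fun k : ℕ => (k : ℝ))).comp_aemeasurable hm
      |>.aestronglyMeasurable

end Probability

end Urn

lemma integrable_of_summable_measureReal_mul {ν : Measure ℕ} [IsFiniteMeasure ν] {g : ℕ → ℝ}
    (h : Summable fun k => ν.real {k} * |g k|) : Integrable g ν := by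
  refine ⟨(measurable_from_nat (f := g)).aestronglyMeasurable, ?_⟩
  rw [hasFiniteIntegral_iff_enorm, lintegral_countable']
  have h1 : ∀ k, ‖g k‖ₑ * ν {k} = ENNReal.ofReal (ν.real {k} * |g k|) := fun k => by
    rw [ENNReal.ofReal_mul measureReal_nonneg, ofReal_measureReal, mul_comm,
      ← Real.enorm_eq_ofReal_abs]
  simp_rw [h1]
  rw [← ENNReal.ofReal_tsum_of_nonneg (fun k => by positivity) h]
  exact ENNReal.ofReal_lt_top

lemma rpow_natCast_mul_add_one {x : ℝ} (hx : 0 < x) (α : ℝ) (p : ℕ) :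
    x ^ (p * α + 1) = (x ^ α) ^ p * x := by
  rw [Real.rpow_add_one hx.ne', mul_comm (p : ℝ), Real.rpow_mul hx.le, Real.rpow_natCast]

section FlowVariance

variable {α L : ℝ} {b r : ℕ → ℝ}

/-- The scaled power sums are controlled by the first one, uniformly in the number of red draws. -/
lemma exists_scaled_powerSum_bounds (hα : 0 < α) (hL : 0 < L) (hb : RateAsymp α L b)
    (hr : RateAsymp α L r) :
    ∃ C : ℝ, 0 ≤ C ∧ ∃ n₀ : ℕ, ∀ n : ℕ, 1 ≤ n → n₀ ≤ n → ∀ k : ℕ, ∀ m : ℝ,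
      m = powerSum b r 1 n k / ((n : ℝ) ^ α * n) →
      |m + L * ((k : ℝ) / n - 1)| ≤ C * (m ^ 2 + 1 / n) ∧
      |powerSum b r 2 n k / (((n : ℝ) ^ α) ^ 2 * n) - 2 * (L ^ 2 / (2 * α + 1))|
        ≤ C * (|m| + m ^ 2 + 1 / n) ∧
      |powerSum b r 3 n k / (((n : ℝ) ^ α) ^ 3 * n)| ≤ C * (1 + |m| ^ 3) ∧
      |powerSum b r 4 n k / (((n : ℝ) ^ α) ^ 4 * n)| ≤ C * (1 + |m| ^ 4) := by
  obtain ⟨C1, hC1, n1, h1⟩ := discrepancy_linearization hα hL hb hr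
  obtain ⟨C2, hC2, n2, h2⟩ := scaled_powerSum_two_approx hα hL hb hr
  obtain ⟨C3, hC3, n3, h3⟩ := scaled_powerSum_le hα hL hb hr (p := 3) (by norm_num)
  obtain ⟨C4, hC4, n4, h4⟩ := scaled_powerSum_le hα hL hb hr (p := 4) (by norm_num)
  refine ⟨C1 + C2 + C3 + C4, by positivity, n1 + n2 + n3 + n4, fun n hn hnN k m hm => ?_⟩
  have hn0 : (0 : ℝ) < n := by exact_mod_cast hn
  have h1 := h1 n k hn (by omega)
  have h2 := h2 n k hn (by omega)
  have h3 := h3 n k hn (by omega)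
  have h4 := h4 n k hn (by omega)
  have e1 : (n : ℝ) ^ (α + 1) = (n : ℝ) ^ α * n := Real.rpow_add_one hn0.ne' α
  have e2 : (n : ℝ) ^ (2 * α + 1) = ((n : ℝ) ^ α) ^ 2 * n := by
    exact_mod_cast rpow_natCast_mul_add_one hn0 α 2
  rw [e1, ← hm] at h1
  rw [e1, ← hm, e2] at h2
  rw [e1, ← hm, rpow_natCast_mul_add_one hn0] at h3 h4
  refine ⟨h1.trans ?_, h2.trans ?_, h3.trans ?_, h4.trans ?_⟩ <;>
    refine mul_le_mul_of_nonneg_right ?_ (by positivity) <;> linarith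

lemma tendsto_scaled_variance (hα : 0 < α) (hL : 0 < L) (hb : RateAsymp α L b)
    (hr : RateAsymp α L r) (hb0 : ∀ i, 0 < b i) (hr0 : ∀ i, 0 < r i) (ν : ℕ → Measure ℕ)
    [∀ n, IsProbabilityMeasure (ν n)]
    (hν : ∀ n k, (ν n).real {k} = blueFlow b r (n + 1) k) :
    Tendsto (fun n : ℕ => ((n + 1 : ℕ) : ℝ)
        * variance (fun k : ℕ => L * ((k : ℝ) / (n + 1 : ℕ) - 1)) (ν n))
      atTop (nhds (2 * (L ^ 2 / (2 * α + 1)))) := by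
  have hT := hr.tendsto_inv hα hL
  have hP := polyBdd_powerSum (b := b) (hr.polyBdd_inv hα hL)
  obtain ⟨C, hC, n₀, hbd⟩ := exists_scaled_powerSum_bounds hα hL hb hr
  obtain ⟨C', N, hvar⟩ := scaled_variance_bound hC
    (by positivity : 0 ≤ 2 * (L ^ 2 / (2 * α + 1)))
  have hInt : ∀ n g, PolyBdd g → Integrable g (ν n) := fun n g hg => by
    refine integrable_of_summable_measureReal_mul ?_
    simp_rw [hν]
    exact summable_blueFlow_mul hb0 hr0 hT (n + 1) hg.abs
  have hharm : ∀ {f : ℕ → ℕ → ℝ}, UrnHarmonic b r f → (∀ i, PolyBdd (f i)) → f 0 0 = 0 →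
      ∀ n c, ∫ k, f (n + 1) k / c ∂(ν n) = 0 := fun {f} hf hpf h0 n c => by
    rw [integral_div, integral_countable (hInt n _ (hpf (n + 1)))]
    simp_rw [hν, smul_eq_mul]
    rw [(hasSum_blueFlow_mul hb0 hr0 hT hf hpf (n + 1)).tsum_eq, h0, zero_div]
  have hzero : ∀ m, powerSum b r m 0 0 = 0 := fun m => by simp [powerSum]
  have key : ∀ n : ℕ, n₀ + N ≤ n → |((n + 1 : ℕ) : ℝ)
        * variance (fun k : ℕ => L * ((k : ℝ) / (n + 1 : ℕ) - 1)) (ν n)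
        - 2 * (L ^ 2 / (2 * α + 1))| ≤ C' / √((n + 1 : ℕ) : ℝ) := by
    intro n hn
    have hM0 : (0 : ℝ) < (n + 1 : ℕ) := by positivity
    have hbd := hbd (n + 1) (by omega) (by omega)
    set y : ℝ := ((n + 1 : ℕ) : ℝ) ^ α with hy
    have hy0 : 0 < y := by positivity
    set M : ℝ := ((n + 1 : ℕ) : ℝ) with hM
    have hdiv : ∀ (f : ℕ → ℝ) (c : ℝ), PolyBdd f → PolyBdd fun k => f k / c := fun f c hf => by
      simpa only [div_eq_mul_inv] using hf.mul (PolyBdd.const c⁻¹)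
    refine hvar (n + 1) (by omega) (by omega) (ν n) (hInt n)
      (fun k => powerSum b r 1 (n + 1) k / (y * M))
      (fun k => powerSum b r 2 (n + 1) k / (y ^ 2 * M))
      (fun k => powerSum b r 3 (n + 1) k / (y ^ 3 * M))
      (fun k => powerSum b r 4 (n + 1) k / (y ^ 4 * M)) _
      (hdiv _ _ (hP 1 _)) (hdiv _ _ (hP 2 _)) (hdiv _ _ (hP 3 _)) (hdiv _ _ (hP 4 _))
      ((PolyBdd.const L).mul ((hdiv _ _ PolyBdd.natCast).sub (PolyBdd.const 1)))
      (hharm (urnHarmonic_powerSum_one hb0 hr0) (hP 1) (hzero 1) n _) ?_ ?_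
      (fun k => (hbd k _ rfl).1) (fun k => (hbd k _ rfl).2.1) (fun k => (hbd k _ rfl).2.2.1)
      (fun k => (hbd k _ rfl).2.2.2)
    · have h := hharm (urnHarmonic_second hb0 hr0) (fun i => ((hP 1 i).pow 2).sub (hP 2 i))
        (by simp [hzero]) n (y ^ 2 * M)
      rw [← integral_const_mul, ← sub_eq_zero, ← integral_sub, ← h]
      · congr 1
        ext k
        rw [← hM]
        field_simp
      · exact (hInt n _ ((hdiv _ _ (hP 1 _)).pow 2)).const_mul _
      · exact hInt n _ (hdiv _ _ (hP 2 _))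
    · have h := hharm (urnHarmonic_fourth hb0 hr0) (fun i =>
        (((((hP 1 i).pow 4).sub (((PolyBdd.const 6).mul ((hP 1 i).pow 2)).mul (hP 2 i))).add
          ((PolyBdd.const 3).mul ((hP 2 i).pow 2))).add
          (((PolyBdd.const 8).mul (hP 1 i)).mul (hP 3 i))).sub ((PolyBdd.const 6).mul (hP 4 i)))
        (by simp [hzero]) n (y ^ 4 * M ^ 4)
      rw [← h]
      congr 1
      ext k
      rw [← hM]
      field_simp
  have hlim : Tendsto (fun n : ℕ => C' / √((n + 1 : ℕ) : ℝ)) atTop (nhds 0) :=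
    tendsto_const_nhds.div_atTop ((Real.tendsto_sqrt_atTop.comp tendsto_natCast_atTop_atTop).comp
      (tendsto_add_atTop_nat 1))
  refine tendsto_iff_norm_sub_tendsto_zero.2 (squeeze_zero' (.of_forall fun _ => norm_nonneg _)
    ?_ hlim)
  filter_upwards [eventually_ge_atTop (n₀ + N)] with n hn
  exact key n hn

end FlowVariance

theorem variance_discrepancy_at_tau_limit {Ω : Type*} [MeasurableSpace Ω] (μ : MeasureTheory.Measure Ω) [MeasureTheory.IsProbabilityMeasure μ]
    (α B : ℝ) (hα : 0 < α) (w : ℕ → ℝ) (hw : ∀ n, 0 < w n)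
    (hasymp : WeightAsymp w α B)
    (b r : ℕ → ℝ) (hb : ∀ i, 0 < b i) (hr : ∀ i, 0 < r i)
    (hchoice : UrnChoice w b r) (U : Urn μ b r) :
    Tendsto (fun n : ℕ => variance (fun ω => (U.D (U.tau n ω) ω : ℝ)) μ / (2*(n:ℝ)))
      atTop (nhds (1 / (2*α + 1))) := by
  have hL : (0 : ℝ) < 2 ^ α := by positivity
  obtain ⟨hb', hr'⟩ := hchoice.rateAsymp hα hasymp
  have hT := hr'.tendsto_inv hα hL
  have hprob : ∀ n, IsProbabilityMeasure (μ.map fun ω => U.Re (U.tau (n + 1) ω) ω) := fun n =>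
    Measure.isProbabilityMeasure_map (U.aemeasurable_Re_tau hb hr hT n)
  have h := (tendsto_scaled_variance hα hL hb' hr' hb hr _
    (U.map_Re_tau_singleton hb hr hT)).div_const (2 * (2 ^ α) ^ 2)
  rw [← tendsto_add_atTop_iff_nat 1]
  convert h using 2
  · rename_i n
    set M : ℝ := ((n + 1 : ℕ) : ℝ) with hM
    have hM0 : 0 < M := by positivity
    have e : (fun k : ℕ => (2 : ℝ) ^ α * ((k : ℝ) / M - 1))
        = fun k : ℕ => 2 ^ α / M * ((k : ℝ) - M) := by
      ext k; field_simp
    rw [U.variance_D_tau hb hr hT n, e, variance_const_mul, variance_sub_const (by fun_prop)]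
    field_simp
  · field_simp
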